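/- Let n ≥ 2 and suppose the cluster pattern with initial seed (B, (u_1,…,u_n)) is of type B_n. Then for every cluster (y_1,…,y_n) of the pattern, the denominator vectors den(y_1), …, den(y_n), taken with respect to the initial cluster (u_1,…,u_n), are linearly independent over ℚ; in particular they form a basis of ℚ^n. -/

import Mathlib

open MvPolynomial Matrix

noncomputable section

/-- The ambient field `ℚ(u_1, …, u_n)`. -/
abbrev CAField (n : ℕ) : Type := FractionRing (MvPolynomial (Fin n) ℚ)

/-- The initial cluster variables `u_i`. -/
def uVar (n : ℕ) (i : Fin n) : CAField n :=
  algebraMap (MvPolynomial (Fin n) ℚ) (CAField n) (X i)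

/-- Fomin–Zelevinsky matrix mutation in direction `k`. -/
def mutMat {n : ℕ} (k : Fin n) (B : Matrix (Fin n) (Fin n) ℤ) :
    Matrix (Fin n) (Fin n) ℤ := fun i j =>
  if i = k ∨ j = k then -B i j
  else B i j + (B i k).sign * max (B i k * B k j) 0

/-- Seed mutation in direction `k`: the matrix mutates by `mutMat` and the
`k`-th cluster variable `x_k` is replaced by
`(∏ x_i^{[B_ik]_+} + ∏ x_i^{[-B_ik]_+}) / x_k`. -/
def mutSeed {n : ℕ} (k : Fin n)
    (s : Matrix (Fin n) (Fin n) ℤ × (Fin n → CAField n)) :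
    Matrix (Fin n) (Fin n) ℤ × (Fin n → CAField n) :=
  (mutMat k s.1,
    Function.update s.2 k
      ((∏ i, s.2 i ^ (s.1 i k).toNat + ∏ i, s.2 i ^ (-(s.1 i k)).toNat) / s.2 k))

/-- The seeds of the cluster pattern with initial exchange matrix `B₀` and
initial cluster `(u_1, …, u_n)`: all seeds reachable from the initial seed
by finite sequences of mutations. -/
def IsSeed {n : ℕ} (B₀ : Matrix (Fin n) (Fin n) ℤ)
    (s : Matrix (Fin n) (Fin n) ℤ × (Fin n → CAField n)) : Prop :=
  Relation.ReflTransGen (fun a b => ∃ k, b = mutSeed k a) (B₀, uVar n) s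

/-- `B` is skew-symmetrizable: `D * B` is skew-symmetric for some diagonal `D`
with positive integer diagonal entries. -/
def SkewSymmetrizable {n : ℕ} (B : Matrix (Fin n) (Fin n) ℤ) : Prop :=
  ∃ d : Fin n → ℤ, (∀ i, 0 < d i) ∧
    (Matrix.diagonal d * B)ᵀ = -(Matrix.diagonal d * B)

/-- The Cartan counterpart `A(B)` of `B`. -/
def cartanCounterpart {n : ℕ} (B : Matrix (Fin n) (Fin n) ℤ) :
    Matrix (Fin n) (Fin n) ℤ := fun i j => if i = j then 2 else -|B i j|

/-- The Cartan matrix of type `B_n` (with rows and columns indexed by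
`0, …, n-1`): `2` on the diagonal, `-2` in position `(n-1, n-2)`, and `-1`
in the remaining positions `(i, i±1)`. -/
def cartanB (n : ℕ) : Matrix (Fin n) (Fin n) ℤ := fun i j =>
  if i = j then 2
  else if i.val + 1 = n ∧ j.val + 2 = n then -2
  else if i.val + 1 = j.val ∨ j.val + 1 = i.val then -1 else 0

/-- The cluster pattern with initial matrix `B₀` is of the finite type with
Cartan matrix `Cmat`: some seed of the pattern has exchange matrix whose
Cartan counterpart equals `Cmat` up to simultaneous permutation of rows and
columns. -/
def PatternOfType {n : ℕ} (Cmat B₀ : Matrix (Fin n) (Fin n) ℤ) : Prop :=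
  ∃ s, IsSeed B₀ s ∧ ∃ σ : Equiv.Perm (Fin n),
    ∀ i j, cartanCounterpart s.1 (σ i) (σ j) = Cmat i j

/-- `d` is the denominator vector of `y` with respect to the cluster `z`:
`y = f(z_1, …, z_n) / ∏ z_i^{d_i}` with `f` an integer polynomial not
divisible by any variable. -/
def IsDenomVec {n : ℕ} (z : Fin n → CAField n) (y : CAField n)
    (d : Fin n → ℤ) : Prop :=
  ∃ f : MvPolynomial (Fin n) ℤ, (∀ i, ¬ X i ∣ f) ∧
    y = MvPolynomial.aeval z f / ∏ i, z i ^ d i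


/-! ## Part 1: crossing numbers of periodic chords -/

/-- Crossing indicator of the chords `(x,y)` and `(p,v)` of the half plane. -/
def crs (x y p v : ℤ) : ℤ :=
  if (x < p ∧ p < y ∧ y < v) ∨ (p < x ∧ x < v ∧ v < y) then 1 else 0

/-- Number of translates (by multiples of `m`) of `(x,y)` crossing `(p,v)`. -/
def crossNum (m x y p v : ℤ) : ℤ := ∑ᶠ k : ℤ, crs (x + k * m) (y + k * m) p v

/-- `(p,v)` is a translate of `(x,y)`. -/
def Eqv (m x y p v : ℤ) : Prop := ∃ k : ℤ, p = x + k * m ∧ v = y + k * m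

lemma crs_nonneg (x y p v : ℤ) : 0 ≤ crs x y p v := by
  unfold crs; split_ifs <;> simp

lemma crs_supp {m : ℤ} (hm : 0 < m) (x y p v : ℤ) :
    (Function.support fun k : ℤ => crs (x + k * m) (y + k * m) p v).Finite := by
  apply (Set.finite_Icc (-(|x| + |y| + |p| + |v|)) (|x| + |y| + |p| + |v|)).subset
  intro k hk
  rw [Function.mem_support] at hk
  unfold crs at hk
  have hk' : (x + k * m < p ∧ p < y + k * m ∧ y + k * m < v) ∨
      (p < x + k * m ∧ x + k * m < v ∧ v < y + k * m) := by
    by_contra h; simp [h] at hk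
  have h1 := neg_abs_le x; have h2 := neg_abs_le y; have h3 := neg_abs_le p; have h4 := neg_abs_le v
  have g1 := le_abs_self x; have g2 := le_abs_self y; have g3 := le_abs_self p; have g4 := le_abs_self v
  have a1 := abs_nonneg x; have a2 := abs_nonneg y; have a3 := abs_nonneg p; have a4 := abs_nonneg v
  have l1 : k * m < |x| + |y| + |p| + |v| := by omega
  have l2 : -(|x| + |y| + |p| + |v|) < k * m := by omega
  rw [Set.mem_Icc]
  constructor <;> by_contra hc <;> push Not at hc <;> nlinarith

lemma crossNum_nonneg (m x y p v : ℤ) : 0 ≤ crossNum m x y p v :=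
  finsum_nonneg fun _ => crs_nonneg _ _ _ _

/-- Sum of an arbitrary combination. -/
lemma crossNum_comb {m : ℤ} (hm : 0 < m) (x y a b c d a' b' c' d' : ℤ) :
    crossNum m x y a b + crossNum m x y c d - (crossNum m x y a' b' + crossNum m x y c' d') =
    ∑ᶠ k : ℤ, (crs (x + k * m) (y + k * m) a b + crs (x + k * m) (y + k * m) c d -
      (crs (x + k * m) (y + k * m) a' b' + crs (x + k * m) (y + k * m) c' d')) := by
  unfold crossNum
  have f1 := crs_supp hm x y a b
  have f2 := crs_supp hm x y c d
  have f3 := crs_supp hm x y a' b'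
  have f4 := crs_supp hm x y c' d'
  rw [finsum_sub_distrib, finsum_add_distrib f1 f2, finsum_add_distrib f3 f4]
  · exact (f1.union f2).subset (Function.support_add _ _)
  · exact (f3.union f4).subset (Function.support_add _ _)

lemma crs_ge {x y p0 p1 p2 p3 : ℤ} (h01 : p0 < p1) (h12 : p1 < p2) (h23 : p2 < p3)
    (hxy : x < y) :
    crs x y p0 p1 + crs x y p2 p3 ≤ crs x y p0 p2 + crs x y p1 p3 ∧
    crs x y p1 p2 + crs x y p0 p3 ≤ crs x y p0 p2 + crs x y p1 p3 := by
  unfold crs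
  constructor <;> split_ifs <;> omega

set_option maxHeartbeats 2000000 in
lemma crs_type1 {x y p0 p1 p2 p3 : ℤ} (h01 : p0 < p1) (h12 : p1 < p2) (h23 : p2 < p3)
    (hxy : x < y) (n1 : ¬ (x = p0 ∧ y = p2)) (n2 : ¬ (x = p1 ∧ y = p3))
    (c1 : crs x y p0 p2 + crs x y p1 p3 ≠ crs x y p0 p1 + crs x y p2 p3) :
    (x < p0 ∧ p1 ≤ y ∧ y ≤ p2) ∨ (p1 ≤ x ∧ x ≤ p2 ∧ p3 < y) ∨
      (x = p0 ∧ p1 < y ∧ y < p2) ∨ (p1 < x ∧ x < p2 ∧ y = p3) := by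
  unfold crs at c1
  split_ifs at c1 <;> omega

set_option maxHeartbeats 2000000 in
lemma crs_type2 {z w p0 p1 p2 p3 : ℤ} (h01 : p0 < p1) (h12 : p1 < p2) (h23 : p2 < p3)
    (hzw : z < w) (n3 : ¬ (z = p0 ∧ w = p2)) (n4 : ¬ (z = p1 ∧ w = p3))
    (c1 : crs z w p0 p2 + crs z w p1 p3 ≠ crs z w p1 p2 + crs z w p0 p3) :
    (p0 < z ∧ z < p1 ∧ p2 ≤ w ∧ w ≤ p3) ∨ (p0 ≤ z ∧ z ≤ p1 ∧ p2 < w ∧ w < p3) := by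
  unfold crs at c1
  split_ifs at c1 <;> omega

lemma crs_or {m x y z w p0 p1 p2 p3 : ℤ} (h01 : p0 < p1) (h12 : p1 < p2) (h23 : p2 < p3)
    (hxy : x < y) (hxm : y ≤ x + m) (q1 : p2 ≤ p0 + m) (q2 : p3 ≤ p1 + m)
    (n1 : ¬ (x = p0 ∧ y = p2)) (n2 : ¬ (x = p1 ∧ y = p3))
    (n3 : ¬ (z = p0 ∧ w = p2)) (n4 : ¬ (z = p1 ∧ w = p3))
    (hl : w - z = y - x) (hd : x = z ∨ x + m ≤ z ∨ z + m ≤ x) :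
    crs x y p0 p2 + crs x y p1 p3 = crs x y p0 p1 + crs x y p2 p3 ∨
    crs z w p0 p2 + crs z w p1 p3 = crs z w p1 p2 + crs z w p0 p3 := by
  by_contra hcon
  push Not at hcon
  obtain ⟨c1, c2⟩ := hcon
  have k1 := crs_type1 h01 h12 h23 hxy n1 n2 c1
  have k2 := crs_type2 h01 h12 h23 (by omega) n3 n4 c2
  clear c1 c2
  omega

lemma mul_gap {m : ℤ} (hm : 0 < m) (k l : ℤ) : k * m = l * m ∨ k * m + m ≤ l * m ∨ l * m + m ≤ k * m := by
  rcases lt_trichotomy k l with h | h | h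
  · right; left; nlinarith
  · left; rw [h]
  · right; right; nlinarith

/-- Tropical Ptolemy relation for the crossing numbers of a single chord orbit. -/
lemma crossNum_ptolemy {m x y p0 p1 p2 p3 : ℤ} (hm : 0 < m)
    (h01 : p0 < p1) (h12 : p1 < p2) (h23 : p2 < p3)
    (hxy : x < y) (hxm : y ≤ x + m) (q1 : p2 ≤ p0 + m) (q2 : p3 ≤ p1 + m)
    (n1 : ¬ Eqv m x y p0 p2) (n2 : ¬ Eqv m x y p1 p3) :
    crossNum m x y p0 p2 + crossNum m x y p1 p3 =
      max (crossNum m x y p0 p1 + crossNum m x y p2 p3)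
        (crossNum m x y p1 p2 + crossNum m x y p0 p3) := by
  have N1 : ∀ k : ℤ, ¬ (x + k * m = p0 ∧ y + k * m = p2) := fun k h => n1 ⟨k, h.1.symm, h.2.symm⟩
  have N2 : ∀ k : ℤ, ¬ (x + k * m = p1 ∧ y + k * m = p3) := fun k h => n2 ⟨k, h.1.symm, h.2.symm⟩
  have e1 := crossNum_comb hm x y p0 p2 p1 p3 p0 p1 p2 p3
  have e2 := crossNum_comb hm x y p0 p2 p1 p3 p1 p2 p0 p3
  have ge := fun k : ℤ => crs_ge h01 h12 h23 (show x + k * m < y + k * m by omega)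
  have g1 : 0 ≤ crossNum m x y p0 p2 + crossNum m x y p1 p3 -
      (crossNum m x y p0 p1 + crossNum m x y p2 p3) := by
    rw [e1]; exact finsum_nonneg fun k => by have := (ge k).1; omega
  have g2 : 0 ≤ crossNum m x y p0 p2 + crossNum m x y p1 p3 -
      (crossNum m x y p1 p2 + crossNum m x y p0 p3) := by
    rw [e2]; exact finsum_nonneg fun k => by have := (ge k).2; omega
  have key : (∀ k : ℤ, crs (x + k * m) (y + k * m) p0 p2 + crs (x + k * m) (y + k * m) p1 p3 =
        crs (x + k * m) (y + k * m) p0 p1 + crs (x + k * m) (y + k * m) p2 p3) ∨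
      (∀ k : ℤ, crs (x + k * m) (y + k * m) p0 p2 + crs (x + k * m) (y + k * m) p1 p3 =
        crs (x + k * m) (y + k * m) p1 p2 + crs (x + k * m) (y + k * m) p0 p3) := by
    by_contra hcon
    push Not at hcon
    obtain ⟨⟨k, hk⟩, ⟨l, hl⟩⟩ := hcon
    have hg := mul_gap hm k l
    rcases crs_or (m := m) (x := x + k * m) (y := y + k * m) (z := x + l * m) (w := y + l * m) h01 h12 h23
      (by omega) (by omega) q1 q2 (N1 k) (N2 k) (N1 l) (N2 l) (by omega) (by omega) with h | h
    · exact hk h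
    · exact hl h
  rcases key with h | h
  · have : crossNum m x y p0 p2 + crossNum m x y p1 p3 -
      (crossNum m x y p0 p1 + crossNum m x y p2 p3) = 0 := by
      rw [e1]; exact finsum_eq_zero_of_forall_eq_zero fun k => by rw [h k]; ring
    omega
  · have : crossNum m x y p0 p2 + crossNum m x y p1 p3 -
      (crossNum m x y p1 p2 + crossNum m x y p0 p3) = 0 := by
      rw [e2]; exact finsum_eq_zero_of_forall_eq_zero fun k => by rw [h k]; ring
    omega

lemma crs_shift (t x y p v : ℤ) : crs (x + t) (y + t) (p + t) (v + t) = crs x y p v := by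
  unfold crs; congr 1; apply propext; omega

lemma crs_symm (x y p v : ℤ) : crs x y p v = crs p v x y := by
  unfold crs; congr 1; apply propext; omega

lemma crossNum_shift_left (m x y p v t : ℤ) :
    crossNum m (x + t * m) (y + t * m) p v = crossNum m x y p v := by
  unfold crossNum
  rw [← finsum_comp_equiv (Equiv.addRight t) (f := fun k : ℤ => crs (x + k * m) (y + k * m) p v)]
  apply finsum_congr; intro k
  simp only [Equiv.coe_addRight]; congr 1 <;> ring

lemma crossNum_shift (m x y p v t : ℤ) :
    crossNum m x y (p + t * m) (v + t * m) = crossNum m x y p v := by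
  rw [← crossNum_shift_left m x y (p + t * m) (v + t * m) t]
  unfold crossNum
  apply finsum_congr; intro k
  rw [← crs_shift (t * m) (x + k * m)]; congr 1 <;> ring

lemma crossNum_symm (m x y p v : ℤ) : crossNum m x y p v = crossNum m p v x y := by
  unfold crossNum
  rw [← finsum_comp_equiv (Equiv.neg ℤ) (f := fun k : ℤ => crs (p + k * m) (v + k * m) x y)]
  apply finsum_congr; intro k
  rw [crs_symm, ← crs_shift (-(k * m))]; simp only [Equiv.neg_apply]; congr 1 <;> ring

lemma crossNum_boundary (m x y p : ℤ) : crossNum m x y p (p + 1) = 0 := by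
  unfold crossNum
  apply finsum_eq_zero_of_forall_eq_zero; intro k
  unfold crs; rw [if_neg (by omega)]

lemma Eqv.shift {m x y p v : ℤ} (t : ℤ) : Eqv m x y (p + t * m) (v + t * m) ↔ Eqv m x y p v := by
  constructor
  · rintro ⟨k, h1, h2⟩; exact ⟨k - t, by linarith, by linarith⟩
  · rintro ⟨k, h1, h2⟩; exact ⟨k + t, by linarith, by linarith⟩

lemma Eqv.symm {m x y p v : ℤ} (h : Eqv m x y p v) : Eqv m p v x y := by
  obtain ⟨k, h1, h2⟩ := h; exact ⟨-k, by linarith, by linarith⟩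

lemma Eqv.refl (m x y : ℤ) : Eqv m x y x y := ⟨0, by ring, by ring⟩

lemma Eqv.crossNum {m x y p v : ℤ} (h : Eqv m x y p v) (a c : ℤ) :
    crossNum m x y a c = crossNum m p v a c := by
  obtain ⟨k, h1, h2⟩ := h
  rw [h1, h2, crossNum_shift_left]

lemma Eqv.eqv {m x y p v : ℤ} (h : Eqv m x y p v) (a c : ℤ) :
    Eqv m x y a c ↔ Eqv m p v a c := by
  obtain ⟨k, h1, h2⟩ := h
  constructor
  · rintro ⟨l, h3, h4⟩; exact ⟨l - k, by linarith, by linarith⟩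
  · rintro ⟨l, h3, h4⟩; exact ⟨l + k, by linarith, by linarith⟩

/-- Indicator of `p` lying strictly below the chord `(x,y)`. -/
def und (x y p : ℤ) : ℤ := if x < p ∧ p < y then 1 else 0

lemma und_supp {m : ℤ} (hm : 0 < m) {x y : ℤ} (hxm : y ≤ x + m) (p : ℤ) :
    (Function.support fun k : ℤ => und (x + k * m) (y + k * m) p).Finite := by
  apply (crs_supp hm x y p (p + m)).subset
  intro k hk
  rw [Function.mem_support] at hk ⊢
  unfold und at hk; unfold crs
  have : x + k * m < p ∧ p < y + k * m := by
    by_contra h; simp [h] at hk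
  rw [if_pos (by omega)]; exact one_ne_zero

lemma und_shift {m : ℤ} (x y p : ℤ) :
    ∑ᶠ k : ℤ, und (x + k * m) (y + k * m) (p + m) = ∑ᶠ k : ℤ, und (x + k * m) (y + k * m) p := by
  rw [← finsum_comp_equiv (Equiv.addRight 1)]
  apply finsum_congr; intro k
  unfold und; congr 1; apply propext
  simp only [Equiv.coe_addRight, add_mul, one_mul]; omega

lemma crossNum_long {m x y p q : ℤ} (hm : 0 < m) (hxm : y ≤ x + m)
    (hpq : p ≤ q) : crossNum m x y p (q + m) =
      ∑ᶠ k : ℤ, und (x + k * m) (y + k * m) p + ∑ᶠ k : ℤ, und (x + k * m) (y + k * m) q := by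
  rw [← und_shift x y q, ← finsum_add_distrib (und_supp hm hxm p) (und_supp hm hxm (q + m))]
  unfold crossNum
  apply finsum_congr; intro k
  unfold und crs
  split_ifs <;> omega

/-- Two loops versus a long chord. -/
lemma crossNum_loops {m x y p q : ℤ} (hm : 0 < m) (hxm : y ≤ x + m)
    (hpq : p ≤ q) :
    crossNum m x y p (p + m) + crossNum m x y q (q + m) = 2 * crossNum m x y p (q + m) := by
  rw [crossNum_long hm hxm hpq, crossNum_long hm hxm le_rfl, crossNum_long hm hxm le_rfl]
  ring

/-- If only the `0`-th translate matters, the crossing number is the crossing indicator. -/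
lemma crossNum_window {m x y p v : ℤ} (hm : 0 < m) (hw : y ≤ p + m) (hw' : v ≤ x + m) :
    crossNum m x y p v = crs x y p v := by
  unfold crossNum
  rw [finsum_eq_single _ (0 : ℤ)]
  · simp
  · intro k hk
    have := mul_gap hm k 0
    have h0 : k * m ≠ 0 := by positivity
    unfold crs; rw [if_neg]; omega

open Classical in
/-- Normalised compatibility degree of chords. -/
def cdeg (m x y p v : ℤ) : ℤ :=
  crossNum m x y p v - (if Eqv m x y p v then (if y = x + m then 2 else 1) else 0)

lemma cdeg_shift (m x y p v t : ℤ) : cdeg m x y (p + t * m) (v + t * m) = cdeg m x y p v := by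
  unfold cdeg; rw [crossNum_shift]
  by_cases h : Eqv m x y p v
  · rw [if_pos h, if_pos ((Eqv.shift t).2 h)]
  · rw [if_neg h, if_neg (fun h' => h ((Eqv.shift t).1 h'))]

lemma cdeg_boundary {m x y p v : ℤ} (hv : v = p + 1) (hxy : x + 1 < y) : cdeg m x y p v = 0 := by
  subst hv
  unfold cdeg; rw [crossNum_boundary, if_neg]; · simp
  rintro ⟨k, h1, h2⟩; omega

lemma Eqv.cdeg {m x y p v : ℤ} (h : Eqv m x y p v) (a c : ℤ) :
    cdeg m x y a c = cdeg m p v a c := by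
  unfold _root_.cdeg
  rw [h.crossNum]
  have e : (y = x + m) ↔ v = p + m := by obtain ⟨k, h1, h2⟩ := h; omega
  have h2 := h.eqv a c
  by_cases h3 : Eqv m p v a c
  · rw [if_pos h3, if_pos (h2.2 h3)]; simp only [e]
  · rw [if_neg h3, if_neg (fun h' => h3 (h2.1 h'))]

lemma Eqv_window {m x y p v : ℤ} (hm : 0 < m) (hw : x < p + m) (hw' : p < x + m) :
    Eqv m x y p v ↔ (x = p ∧ y = v) := by
  constructor
  · rintro ⟨k, h1, h2⟩
    have := mul_gap hm k 0
    omega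
  · rintro ⟨h1, h2⟩; exact ⟨0, by omega, by omega⟩

lemma cdeg_window {m x y p v : ℤ} (hm : 0 < m) (hw : y ≤ p + m) (hw' : v ≤ x + m)
    (h1 : x < p + m) (h2 : p < x + m) : cdeg m x y p v =
    crs x y p v - (if x = p ∧ y = v then (if y = x + m then 2 else 1) else 0) := by
  unfold cdeg
  rw [crossNum_window hm hw hw']
  have h3 := Eqv_window (y := y) (v := v) hm h1 h2
  by_cases h : x = p ∧ y = v
  · rw [if_pos h, if_pos (h3.2 h)]
  · rw [if_neg h, if_neg (fun h' => h (h3.1 h'))]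

lemma cdeg_of_not {m x y p v : ℤ} (h : ¬ Eqv m x y p v) : cdeg m x y p v = crossNum m x y p v := by
  unfold cdeg; rw [if_neg h, sub_zero]

/-- Tropical Ptolemy relation. -/
lemma cdeg_ptolemy {m x y p0 p1 p2 p3 : ℤ} (hm : 0 < m)
    (h01 : p0 < p1) (h12 : p1 < p2) (h23 : p2 < p3) (h30 : p3 ≤ p0 + m)
    (hxy : x < y) (hxm : y ≤ x + m) :
    cdeg m x y p0 p2 + cdeg m x y p1 p3 =
      max (cdeg m x y p0 p1 + cdeg m x y p2 p3) (cdeg m x y p1 p2 + cdeg m x y p0 p3) := by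
  have main : ∀ a c, Eqv m x y a c → p0 ≤ a → a < c → c ≤ p3 →
      cdeg m x y p0 p2 + cdeg m x y p1 p3 =
      (crs a c p0 p2 - if a = p0 ∧ c = p2 then (if c = a + m then 2 else 1) else 0) +
      (crs a c p1 p3 - if a = p1 ∧ c = p3 then (if c = a + m then 2 else 1) else 0) ∧
      cdeg m x y p0 p1 + cdeg m x y p2 p3 =
      (crs a c p0 p1 - if a = p0 ∧ c = p1 then (if c = a + m then 2 else 1) else 0) +
      (crs a c p2 p3 - if a = p2 ∧ c = p3 then (if c = a + m then 2 else 1) else 0) ∧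
      cdeg m x y p1 p2 + cdeg m x y p0 p3 =
      (crs a c p1 p2 - if a = p1 ∧ c = p2 then (if c = a + m then 2 else 1) else 0) +
      (crs a c p0 p3 - if a = p0 ∧ c = p3 then (if c = a + m then 2 else 1) else 0) := by
    intro a c h ha hac hc
    rw [h.cdeg p0 p2, h.cdeg p1 p3, h.cdeg p0 p1, h.cdeg p2 p3, h.cdeg p1 p2, h.cdeg p0 p3]
    refine ⟨?_, ?_, ?_⟩ <;>
    rw [cdeg_window hm (by omega) (by omega) (by omega) (by omega),
      cdeg_window hm (by omega) (by omega) (by omega) (by omega)]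
  by_cases hE : Eqv m x y p0 p1 ∨ Eqv m x y p0 p2 ∨ Eqv m x y p0 p3 ∨ Eqv m x y p1 p2 ∨
      Eqv m x y p1 p3 ∨ Eqv m x y p2 p3
  · have cr0 : ∀ a b c d : ℤ, ¬ ((a < c ∧ c < b ∧ b < d) ∨ (c < a ∧ a < d ∧ d < b)) →
      crs a b c d = 0 := fun a b c d h => by unfold crs; rw [if_neg h]
    have cr1 : crs p0 p2 p1 p3 = 1 := by unfold crs; rw [if_pos (by omega)]
    have cr2 : crs p1 p3 p0 p2 = 1 := by unfold crs; rw [if_pos (by omega)]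
    rcases hE with h | h | h | h | h | h
    · obtain ⟨e1, e2, e3⟩ := main p0 p1 h (by omega) (by omega) (by omega)
      rw [e1, e2, e3]
      repeat rw [cr0 _ _ _ _ (by omega)]
      split_ifs <;> omega
    · obtain ⟨e1, e2, e3⟩ := main p0 p2 h (by omega) (by omega) (by omega)
      rw [e1, e2, e3, cr1]
      repeat rw [cr0 _ _ _ _ (by omega)]
      split_ifs <;> omega
    · obtain ⟨e1, e2, e3⟩ := main p0 p3 h (by omega) (by omega) (by omega)
      rw [e1, e2, e3]
      repeat rw [cr0 _ _ _ _ (by omega)]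
      split_ifs <;> omega
    · obtain ⟨e1, e2, e3⟩ := main p1 p2 h (by omega) (by omega) (by omega)
      rw [e1, e2, e3]
      repeat rw [cr0 _ _ _ _ (by omega)]
      split_ifs <;> omega
    · obtain ⟨e1, e2, e3⟩ := main p1 p3 h (by omega) (by omega) (by omega)
      rw [e1, e2, e3, cr2]
      repeat rw [cr0 _ _ _ _ (by omega)]
      split_ifs <;> omega
    · obtain ⟨e1, e2, e3⟩ := main p2 p3 h (by omega) (by omega) (by omega)
      rw [e1, e2, e3]
      repeat rw [cr0 _ _ _ _ (by omega)]
      split_ifs <;> omega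
  · push Not at hE
    obtain ⟨a, b, c, d, e, f⟩ := hE
    rw [cdeg_of_not a, cdeg_of_not b, cdeg_of_not c, cdeg_of_not d, cdeg_of_not e, cdeg_of_not f]
    exact crossNum_ptolemy hm h01 h12 h23 hxy hxm (by omega) (by omega) b e

lemma und_loop {m p q : ℤ} (hm : 0 < m) (hpq : p < q) (hqp : q < p + m) :
    ∑ᶠ k : ℤ, und (p + k * m) (p + m + k * m) q = 1 := by
  rw [finsum_eq_single _ (0 : ℤ)]
  · unfold und; rw [if_pos (by omega)]
  · intro k hk
    have := mul_gap hm k 0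
    have h0 : k * m ≠ 0 := by positivity
    unfold und; rw [if_neg]; omega

/-- Loops at different base points cross twice. -/
lemma crossNum_loop_loop {m p q : ℤ} (hm : 0 < m) (hpq : p < q) (hqp : q < p + m) :
    crossNum m p (p + m) q (q + m) = 2 := by
  rw [crossNum_long hm le_rfl le_rfl, und_loop hm hpq hqp]; rfl

lemma cdeg_loops {m x y p q : ℤ} (hm : 0 < m) (hpq : p < q) (hqp : q < p + m)
    (hxy : x < y) (hxm : y ≤ x + m) :
    cdeg m x y p (p + m) + cdeg m x y q (q + m) =
      2 * max (cdeg m x y p q) (cdeg m x y q (p + m)) := by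
  have hll := crossNum_loop_loop hm hpq hqp
  have hll' := crossNum_symm m p (p + m) q (q + m)
  have c1 : cdeg m p (p + m) q (q + m) = 2 := by
    rw [cdeg_of_not, hll]
    rw [Eqv_window hm] <;> omega
  have c2 : cdeg m q (q + m) p (p + m) = 2 := by
    rw [cdeg_of_not, ← hll', hll]
    rw [Eqv_window hm] <;> omega
  by_cases hE : Eqv m x y p (p + m) ∨ Eqv m x y q (q + m) ∨ Eqv m x y p q ∨ Eqv m x y q (p + m)
  · have cr0 : ∀ a b c d : ℤ, ¬ ((a < c ∧ c < b ∧ b < d) ∨ (c < a ∧ a < d ∧ d < b)) →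
      crs a b c d = 0 := fun a b c d h => by unfold crs; rw [if_neg h]
    rcases hE with h | h | h | h
    · simp only [h.cdeg]
      rw [c1, cdeg_window hm (by omega) (by omega) (by omega) (by omega),
        cdeg_window hm (by omega) (by omega) (by omega) (by omega),
        cdeg_window hm (by omega) (by omega) (by omega) (by omega)]
      repeat rw [cr0 _ _ _ _ (by omega)]
      split_ifs <;> omega
    · have h' := (Eqv.shift (-1)).2 h
      simp only [h.cdeg]
      rw [c2, cdeg_window (p := q) (v := q + m) hm (by omega) (by omega) (by omega) (by omega),
        cdeg_window (p := q) (v := p + m) hm (by omega) (by omega) (by omega) (by omega)]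
      have c3 : cdeg m q (q + m) p q = 0 := by
        have := cdeg_shift m q (q + m) p q 1
        rw [← this, cdeg_window hm (by omega) (by omega) (by omega) (by omega),
          cr0 _ _ _ _ (by omega), if_neg (by omega)]; rfl
      rw [c3]
      repeat rw [cr0 _ _ _ _ (by omega)]
      split_ifs <;> omega
    · simp only [h.cdeg]
      have c3 : cdeg m p q q (q + m) = 0 := by
        have := cdeg_shift m p q q (q + m) (-1)
        rw [← this, cdeg_window hm (by omega) (by omega) (by omega) (by omega),
          cr0 _ _ _ _ (by omega), if_neg (by omega)]; rfl
      rw [c3, cdeg_window hm (by omega) (by omega) (by omega) (by omega),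
        cdeg_window hm (by omega) (by omega) (by omega) (by omega),
        cdeg_window hm (by omega) (by omega) (by omega) (by omega)]
      repeat rw [cr0 _ _ _ _ (by omega)]
      split_ifs <;> omega
    · simp only [h.cdeg]
      rw [cdeg_window hm (by omega) (by omega) (by omega) (by omega),
        cdeg_window hm (by omega) (by omega) (by omega) (by omega),
        cdeg_window hm (by omega) (by omega) (by omega) (by omega),
        cdeg_window hm (by omega) (by omega) (by omega) (by omega)]
      repeat rw [cr0 _ _ _ _ (by omega)]
      split_ifs <;> omega
  · push Not at hE
    obtain ⟨a, b, c, d⟩ := hE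
    rw [cdeg_of_not a, cdeg_of_not b, cdeg_of_not c, cdeg_of_not d]
    have h1 := crossNum_ptolemy (p3 := q + m) hm hpq hqp (by omega) hxy hxm (by omega) (by omega) a b
    have h2 := crossNum_loops hm hxm hpq.le
    have h3 := crossNum_shift m x y p q 1
    rw [one_mul] at h3
    omega

/-! ## Part 5: weighted noncrossing periodic families of chords -/

/-- Total weight of the chords at `p` leaving the interval `[a,c]`. -/
def exitW (m : ℤ) (W : ℤ → ℤ → ℚ) (a c p : ℤ) : ℚ :=
  ∑ v ∈ Finset.Ioc c (p + m), W p v + ∑ q ∈ Finset.Ico (p - m) a, W q p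

lemma sum_Ioc_split (f : ℤ → ℚ) {a b c : ℤ} (h1 : a ≤ b) (h2 : b ≤ c) :
    ∑ i ∈ Finset.Ioc a b, f i + ∑ i ∈ Finset.Ioc b c, f i = ∑ i ∈ Finset.Ioc a c, f i := by
  rw [← Finset.Ioc_union_Ioc_eq_Ioc h1 h2, Finset.sum_union (Finset.Ioc_disjoint_Ioc_of_le le_rfl)]

lemma sum_Ico_split (f : ℤ → ℚ) {a b c : ℤ} (h1 : a ≤ b) (h2 : b ≤ c) :
    ∑ i ∈ Finset.Ico a b, f i + ∑ i ∈ Finset.Ico b c, f i = ∑ i ∈ Finset.Ico a c, f i := by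
  rw [← Finset.Ico_union_Ico_eq_Ico h1 h2, Finset.sum_union (Finset.Ico_disjoint_Ico_consecutive a b c)]

section Weights

variable {m : ℤ} {W : ℤ → ℤ → ℚ}

lemma exitW_under (hnc : ∀ a b c d, W a b ≠ 0 → W c d ≠ 0 → ¬ (a < c ∧ c < b ∧ b < d))
    {a c p v q : ℤ} (h : W p v ≠ 0) (hap : a ≤ p) (hpq : p < q) (hqv : q < v) (hvc : v ≤ c) :
    exitW m W a c q = 0 := by
  unfold exitW
  rw [Finset.sum_eq_zero, Finset.sum_eq_zero, add_zero]
  · intro z hz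
    rw [Finset.mem_Ico] at hz
    by_contra hne
    exact hnc _ _ _ _ hne h (by omega)
  · intro z hz
    rw [Finset.mem_Ioc] at hz
    by_contra hne
    exact hnc _ _ _ _ h hne (by omega)

lemma sum_two {s : Finset ℤ} {f : ℤ → ℚ} {p v : ℤ} (w : ℚ) (hpv : p ≠ v)
    (hp : p ∈ s → f p = w) (hv : v ∈ s → f v = w) (h0 : ∀ q ∈ s, q ≠ p → q ≠ v → f q = 0) :
    ∑ q ∈ s, f q = (if p ∈ s then w else 0) + (if v ∈ s then w else 0) := by
  have : ∀ q ∈ s, f q = (if q = p then w else 0) + (if q = v then w else 0) := by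
    intro q hq
    by_cases h1 : q = p
    · subst h1; rw [if_pos rfl, if_neg hpv, add_zero, hp hq]
    · by_cases h2 : q = v
      · subst h2; rw [if_pos rfl, if_neg h1, zero_add, hv hq]
      · rw [if_neg h1, if_neg h2, add_zero, h0 q hq h1 h2]
  rw [Finset.sum_congr rfl this, Finset.sum_add_distrib, Finset.sum_ite_eq', Finset.sum_ite_eq']

/-- The inductive step through a triangle `(a,b,c)`. -/
lemma weights_step (hnc : ∀ a b c d, W a b ≠ 0 → W c d ≠ 0 → ¬ (a < c ∧ c < b ∧ b < d))
    {a b c : ℤ} (hab : a < b) (hbc : b < c) (hca : c ≤ a + m)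
    (h1 : ∀ p, a < p → p < b → exitW m W a b p = 0)
    (h2 : ∀ p, b < p → p < c → exitW m W b c p = 0)
    (hac : W a c = 0) (hJ : ∑ p ∈ Finset.Ioo a c, exitW m W a c p = 0) :
    (∀ p v, a ≤ p → p < b → b < v → v ≤ c → W p v = 0) ∧
    ∀ p, a < p → p < c → exitW m W a c p = 0 := by
  have L : ∀ p, a < p → p < b → exitW m W a c p = - ∑ v ∈ Finset.Ioc b c, W p v := by
    intro p hp hp'
    have := h1 p hp hp'
    unfold exitW at this ⊢
    rw [← sum_Ioc_split _ (show b ≤ c by omega) (show c ≤ p + m by omega)] at this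
    linarith
  have R : ∀ v, b < v → v < c → exitW m W a c v = - ∑ q ∈ Finset.Ico a b, W q v := by
    intro p hp hp'
    have := h2 p hp hp'
    unfold exitW at this ⊢
    rw [← sum_Ico_split _ (show p - m ≤ a by omega) (show a ≤ b by omega)] at this
    linarith
  have claim : ∀ N : ℕ, ∀ p v, a ≤ p → p < b → b < v → v ≤ c → (v - p).toNat = N → W p v = 0 := by
    intro N
    induction N using Nat.strong_induction_on with
    | _ N ih =>
    intro p v hap hpb hbv hvc hN
    have ih' : ∀ p' v', a ≤ p' → p' < b → b < v' → v' ≤ c → v' - p' < v - p → W p' v' = 0 := by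
      intro p' v' i1 i2 i3 i4 i5
      exact ih (v' - p').toNat (by omega) p' v' i1 i2 i3 i4 rfl
    by_contra hne
    have sumP : (∀ v', v < v' → v' ≤ c → W p v' = 0) → ∑ v' ∈ Finset.Ioc b c, W p v' = W p v := by
      intro h
      apply Finset.sum_eq_single v
      · intro v' hv' hne'
        rw [Finset.mem_Ioc] at hv'
        rcases lt_or_gt_of_ne hne' with h3 | h3
        · exact ih' p v' hap hpb hv'.1 hv'.2 (by omega)
        · exact h v' h3 hv'.2
      · intro h; exact absurd (Finset.mem_Ioc.2 ⟨hbv, hvc⟩) h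
    have sumV : (∀ p', a ≤ p' → p' < p → W p' v = 0) → ∑ q ∈ Finset.Ico a b, W q v = W p v := by
      intro h
      apply Finset.sum_eq_single p
      · intro v' hv' hne'
        rw [Finset.mem_Ico] at hv'
        rcases lt_or_gt_of_ne hne' with h3 | h3
        · exact h v' hv'.1 h3
        · exact ih' v' v hv'.1 hv'.2 hbv hvc (by omega)
      · intro h; exact absurd (Finset.mem_Ico.2 ⟨hap, hpb⟩) h
    by_cases c1 : ∃ p', a ≤ p' ∧ p' < p ∧ W p' v ≠ 0
    · obtain ⟨p', q1, q2, q3⟩ := c1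
      have e1 := L p (by omega) hpb
      rw [exitW_under hnc q3 q1 q2 (by omega) hvc, sumP] at e1
      · exact hne (by linarith)
      · intro v' hv' _
        by_contra h; exact hnc _ _ _ _ q3 h (by omega)
    by_cases c2 : ∃ v', v < v' ∧ v' ≤ c ∧ W p v' ≠ 0
    · obtain ⟨v', q1, q2, q3⟩ := c2
      have e1 := R v hbv (by omega)
      rw [exitW_under hnc q3 hap (by omega) q1 q2, sumV] at e1
      · exact hne (by linarith)
      · intro p' _ hp'
        by_contra h; exact hnc _ _ _ _ h q3 (by omega)
    push Not at c1 c2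
    have eP : a < p → exitW m W a c p = - W p v := fun h => by rw [L p h hpb, sumP c2]
    have eV : v < c → exitW m W a c v = - W p v := fun h => by rw [R v hbv h, sumV c1]
    by_cases c3 : ∃ p' v', a ≤ p' ∧ p' < p ∧ v < v' ∧ v' ≤ c ∧ W p' v' ≠ 0
    · obtain ⟨p', v', q1, q2, q3, q4, q5⟩ := c3
      have e1 := eP (by omega)
      rw [exitW_under hnc q5 q1 q2 (by omega) q4] at e1
      exact hne (by linarith)
    push Not at c3
    have hsum := sum_two (s := Finset.Ioo a c) (f := exitW m W a c) (p := p) (v := v) (- W p v)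
      (by omega) (fun h => eP (Finset.mem_Ioo.1 h).1) (fun h => eV (Finset.mem_Ioo.1 h).2) (by
        intro q hq hqp hqv
        rw [Finset.mem_Ioo] at hq
        by_cases d1 : q < p
        · rw [L q hq.1 (by omega), Finset.sum_eq_zero, neg_zero]
          intro v' hv'
          rw [Finset.mem_Ioc] at hv'
          rcases lt_trichotomy v' v with d | d | d
          · by_contra h; exact hnc _ _ _ _ h hne (by omega)
          · rw [d]; exact c1 q (by omega) d1
          · exact c3 q v' (by omega) d1 d hv'.2
        by_cases d2 : v < q
        · rw [R q (by omega) hq.2, Finset.sum_eq_zero, neg_zero]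
          intro p' hp'
          rw [Finset.mem_Ico] at hp'
          rcases lt_trichotomy p' p with d | d | d
          · exact c3 p' q hp'.1 d d2 (by omega)
          · rw [d]; exact c2 q d2 (by omega)
          · by_contra h; exact hnc _ _ _ _ hne h (by omega)
        · exact exitW_under hnc hne hap (by omega) (by omega) hvc)
    rw [hJ] at hsum
    have hne2 : p ≠ a ∨ v ≠ c := by
      by_contra h; push Not at h; rw [h.1, h.2] at hne; exact hne hac
    apply hne
    split_ifs at hsum with g1 g2 g2
    · linarith
    · linarith
    · linarith
    · exfalso; rw [Finset.mem_Ioo] at g1 g2; omega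
  have claim' : ∀ p v, a ≤ p → p < b → b < v → v ≤ c → W p v = 0 :=
    fun p v i1 i2 i3 i4 => claim _ p v i1 i2 i3 i4 rfl
  have ne_b : ∀ p, a < p → p < c → p ≠ b → exitW m W a c p = 0 := by
    intro p hp hp' hpb
    rcases lt_or_gt_of_ne hpb with h | h
    · rw [L p hp h, Finset.sum_eq_zero, neg_zero]
      intro v hv; rw [Finset.mem_Ioc] at hv; exact claim' p v hp.le h hv.1 hv.2
    · rw [R p h hp', Finset.sum_eq_zero, neg_zero]
      intro v hv; rw [Finset.mem_Ico] at hv; exact claim' v p hv.1 hv.2 h hp'.le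
  refine ⟨claim', fun p hp hp' => ?_⟩
  by_cases hpb : p = b
  · subst hpb
    rw [← hJ]; symm
    apply Finset.sum_eq_single
    · intro q hq hne; rw [Finset.mem_Ioo] at hq; exact ne_b q hq.1 hq.2 hne
    · intro h; exact absurd (Finset.mem_Ioo.2 ⟨hp, hp'⟩) h
  · exact ne_b p hp hp' hpb

/-- Vanishing inside all arcs of a tree. -/
lemma weights_tree (hnc : ∀ a b c d, W a b ≠ 0 → W c d ≠ 0 → ¬ (a < c ∧ c < b ∧ b < d))
    (hlen : ∀ p v, W p v ≠ 0 → p + 2 ≤ v ∧ v ≤ p + m) (A : ℤ → ℤ → Prop)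
    (hA : ∀ a c, A a c → c ≤ a + m ∧ W a c = 0 ∧ ∑ p ∈ Finset.Ioo a c, exitW m W a c p = 0 ∧
      ∃ b, a < b ∧ b < c ∧ (b = a + 1 ∨ A a b) ∧ (c = b + 1 ∨ A b c)) :
    ∀ N : ℕ, ∀ a c, (c = a + 1 ∨ A a c) → (c - a).toNat = N →
      (∀ p v, a ≤ p → v ≤ c → W p v = 0) ∧ ∀ p, a < p → p < c → exitW m W a c p = 0 := by
  intro N
  induction N using Nat.strong_induction_on with
  | _ N ih =>
  intro a c hac hN
  rcases hac with hac | hac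
  · refine ⟨fun p v h1 h2 => ?_, fun p h1 h2 => by omega⟩
    by_contra h
    have := hlen p v h
    omega
  · obtain ⟨hca, hW, hJ, b, hab, hbc, h1, h2⟩ := hA a c hac
    have i1 := ih (b - a).toNat (by omega) a b h1 rfl
    have i2 := ih (c - b).toNat (by omega) b c h2 rfl
    have st := weights_step hnc hab hbc hca i1.2 i2.2 hW hJ
    refine ⟨fun p v hp hv => ?_, st.2⟩
    by_cases d1 : v ≤ b
    · exact i1.1 p v hp d1
    by_cases d2 : b ≤ p
    · exact i2.1 p v d2 hv
    exact st.1 p v hp (by omega) (by omega) hv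

/-- Vanishing of the weights. -/
lemma weights_zero (hm : 0 < m)
    (hnc : ∀ a b c d, W a b ≠ 0 → W c d ≠ 0 → ¬ (a < c ∧ c < b ∧ b < d))
    (hlen : ∀ p v, W p v ≠ 0 → p + 2 ≤ v ∧ v ≤ p + m)
    (hper : ∀ k p v : ℤ, W (p + k * m) (v + k * m) = W p v) (A : ℤ → ℤ → Prop)
    (hA : ∀ a c, A a c → c ≤ a + m ∧ W a c = 0 ∧ ∑ p ∈ Finset.Ioo a c, exitW m W a c p = 0 ∧
      ∃ b, a < b ∧ b < c ∧ (b = a + 1 ∨ A a b) ∧ (c = b + 1 ∨ A b c))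
    (o : ℤ) (ho : A o (o + m)) (p v : ℤ) : W p v = 0 := by
  obtain ⟨hin, hex⟩ := weights_tree hnc hlen A hA _ o (o + m) (Or.inr ho) rfl
  have hper1 : ∀ p v, W p v = W (p + m) (v + m) := fun p v => by
    have := hper 1 p v; rw [one_mul] at this; exact this.symm
  have claim : ∀ N : ℕ, ∀ p v, o < p → p < o + m → o + m < v → v ≤ p + m →
      (v - p).toNat = N → W p v = 0 := by
    intro N
    induction N using Nat.strong_induction_on with
    | _ N ih =>
    intro p v hp hp' hv hv' hN
    have ih' : ∀ p' v', o < p' → p' < o + m → o + m < v' → v' ≤ p' + m → v' - p' < v - p →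
        W p' v' = 0 := by
      intro p' v' i1 i2 i3 i4 i5
      exact ih (v' - p').toNat (by omega) p' v' i1 i2 i3 i4 rfl
    by_contra hne
    by_cases cA : ∃ v', v < v' ∧ v' ≤ p + m ∧ W p v' ≠ 0
    · obtain ⟨v', q1, q2, q3⟩ := cA
      have e1 := hex (v - m) (by omega) (by omega)
      unfold exitW at e1
      rw [Finset.sum_eq_zero, zero_add, Finset.sum_eq_single (p - m)] at e1
      · rw [hper1] at e1
        rw [sub_add_cancel, sub_add_cancel] at e1
        exact hne e1
      · intro r hr hrne
        rw [Finset.mem_Ico] at hr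
        rw [hper1, sub_add_cancel]
        rcases lt_or_gt_of_ne hrne with d | d
        · by_contra h; exact hnc _ _ _ _ h q3 (by omega)
        · by_cases hh : r + m + m < v
          · by_contra h; have := hlen _ _ h; omega
          · exact ih' _ _ (by omega) (by omega) (by omega) (by omega) (by omega)
      · intro h; exact absurd (Finset.mem_Ico.2 (by omega)) h
      · intro z hz
        rw [Finset.mem_Ioc] at hz
        by_contra h; exact hnc _ _ _ _ h q3 (by omega)
    · push Not at cA
      have e1 := hex p hp hp'
      unfold exitW at e1
      rw [Finset.sum_eq_single v] at e1
      · by_cases hl : v = p + m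
        · rw [Finset.sum_eq_single (p - m)] at e1
          · rw [hper1 (p - m), sub_add_cancel, ← hl] at e1
            exact hne (by linarith)
          · intro r hr hrne
            rw [Finset.mem_Ico] at hr
            rw [hper1]
            exact ih' _ _ (by omega) (by omega) (by omega) (by omega) (by omega)
          · intro h; exact absurd (Finset.mem_Ico.2 (by omega)) h
        · rw [Finset.sum_eq_zero] at e1
          · exact hne (by linarith)
          · intro r hr
            rw [Finset.mem_Ico] at hr
            rw [hper1]
            by_cases hr' : r = p - m
            · rw [hr', sub_add_cancel]; exact cA _ (by omega) le_rfl
            · by_contra h; exact hnc _ _ _ _ hne h (by omega)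
      · intro v' hv' hne'
        rw [Finset.mem_Ioc] at hv'
        rcases lt_or_gt_of_ne hne' with h3 | h3
        · exact ih' p v' hp hp' hv'.1 hv'.2 (by omega)
        · exact cA v' h3 hv'.2
      · intro h; exact absurd (Finset.mem_Ioc.2 ⟨hv, hv'⟩) h
  by_contra hne
  -- translate into the window
  have hmod := Int.emod_nonneg (p - o) hm.ne'
  have hmod' := Int.emod_lt_of_pos (p - o) hm
  have hdiv := Int.emod_add_mul_ediv (p - o) m
  set k := (p - o) / m with hk
  rw [← hper (-k)] at hne
  have hl := hlen _ _ hne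
  have hp1 : o ≤ p + -k * m := by linarith
  have hp2 : p + -k * m < o + m := by linarith
  by_cases h1 : v + -k * m ≤ o + m
  · exact hne (hin _ _ hp1 h1)
  · exact hne (claim _ _ _ (by omega) hp2 (by omega) hl.2 rfl)

end Weights

open Classical in
lemma finsum_progression {m : ℤ} (hm : 0 < m) (x : ℤ) (g : ℤ → ℚ) (s : Finset ℤ)
    (hg : ∀ p, p ∉ s → g p = 0) :
    ∑ᶠ k : ℤ, g (x + k * m) = ∑ p ∈ s, if (∃ k : ℤ, p = x + k * m) then g p else 0 := by
  have hinj : Function.Injective fun k : ℤ => x + k * m := by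
    intro k l h
    have h' : x + k * m = x + l * m := h
    exact mul_right_cancel₀ hm.ne' (by linarith)
  have h1 := finsum_mem_range (f := g) hinj
  rw [← h1, ← finsum_eq_finsetSum_of_support_subset]
  · apply finsum_congr
    intro p
    by_cases hp : ∃ k : ℤ, p = x + k * m
    · rw [if_pos hp, finsum_eq_if, if_pos]
      obtain ⟨k, hk⟩ := hp; exact ⟨k, hk.symm⟩
    · rw [if_neg hp, finsum_eq_if, if_neg]
      rintro ⟨k, hk⟩; exact hp ⟨k, hk.symm⟩
  · intro p hp
    by_contra hps
    rw [Function.mem_support] at hp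
    rw [hg p (by simpa using hps)] at hp
    simp at hp

open Classical in
lemma crossNum_eq_exit {m x y a c : ℤ} (hm : 0 < m) (hxy : x < y) (hxm : y ≤ x + m) :
    ∑ p ∈ Finset.Ioo a c, exitW m (fun p v => if Eqv m x y p v then 1 else 0) a c p =
      (crossNum m x y a c : ℚ) := by
  have f1 : ∀ p ∈ Finset.Ioo a c, ∑ v ∈ Finset.Ioc c (p + m), (if Eqv m x y p v then (1 : ℚ) else 0) =
      if (∃ k : ℤ, p = x + k * m) then (if a < p ∧ p < c ∧ c < p + (y - x) then 1 else 0) else 0 := by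
    intro p hp
    rw [Finset.mem_Ioo] at hp
    by_cases h : ∃ k : ℤ, p = x + k * m
    · rw [if_pos h]
      obtain ⟨k, hk⟩ := h
      rw [Finset.sum_congr rfl (g := fun v => if v = p + (y - x) then (1 : ℚ) else 0),
        Finset.sum_ite_eq']
      · congr 1; rw [Finset.mem_Ioc]; apply propext; omega
      · intro v hv
        congr 1; apply propext
        constructor
        · rintro ⟨l, h1, h2⟩; omega
        · intro h; exact ⟨k, hk, by omega⟩
    · rw [if_neg h]
      apply Finset.sum_eq_zero
      intro v hv
      rw [if_neg]; rintro ⟨k, h1, h2⟩; exact h ⟨k, h1⟩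
  have f2 : ∀ p ∈ Finset.Ioo a c, ∑ q ∈ Finset.Ico (p - m) a, (if Eqv m x y q p then (1 : ℚ) else 0) =
      if (∃ k : ℤ, p = y + k * m) then (if a < p ∧ p < c ∧ p - (y - x) < a then 1 else 0) else 0 := by
    intro p hp
    rw [Finset.mem_Ioo] at hp
    by_cases h : ∃ k : ℤ, p = y + k * m
    · rw [if_pos h]
      obtain ⟨k, hk⟩ := h
      rw [Finset.sum_congr rfl (g := fun v => if v = p - (y - x) then (1 : ℚ) else 0),
        Finset.sum_ite_eq']
      · congr 1; rw [Finset.mem_Ico]; apply propext; omega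
      · intro v hv
        congr 1; apply propext
        constructor
        · rintro ⟨l, h1, h2⟩; omega
        · intro h; exact ⟨k, by omega, hk⟩
    · rw [if_neg h]
      apply Finset.sum_eq_zero
      intro v hv
      rw [if_neg]; rintro ⟨k, h1, h2⟩; exact h ⟨k, h2⟩
  unfold exitW
  rw [Finset.sum_add_distrib, Finset.sum_congr rfl f1, Finset.sum_congr rfl f2,
    ← finsum_progression hm x (fun p => if a < p ∧ p < c ∧ c < p + (y - x) then 1 else 0),
    ← finsum_progression hm y (fun p => if a < p ∧ p < c ∧ p - (y - x) < a then 1 else 0)]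
  · have hc : (crossNum m x y a c : ℚ) = ∑ᶠ k : ℤ, (crs (x + k * m) (y + k * m) a c : ℚ) := by
      unfold crossNum
      exact (Int.castAddHom ℚ).map_finsum (crs_supp hm x y a c)
    rw [hc, ← finsum_add_distrib]
    · apply finsum_congr; intro k
      unfold crs
      by_cases g1 : a < x + k * m ∧ x + k * m < c ∧ c < x + k * m + (y - x)
      · rw [if_pos g1, if_neg (by omega), if_pos (by omega)]; norm_num
      · rw [if_neg g1]
        by_cases g2 : a < y + k * m ∧ y + k * m < c ∧ y + k * m - (y - x) < a
        · rw [if_pos g2, if_pos (by omega)]; norm_num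
        · rw [if_neg g2, if_neg (by omega)]; norm_num
    · apply (crs_supp hm x y a c).subset
      intro k hk
      rw [Function.mem_support] at hk ⊢
      have : a < x + k * m ∧ x + k * m < c ∧ c < x + k * m + (y - x) := by
        by_contra h; rw [if_neg h] at hk; exact hk rfl
      unfold crs; rw [if_pos (by omega)]; exact one_ne_zero
    · apply (crs_supp hm x y a c).subset
      intro k hk
      rw [Function.mem_support] at hk ⊢
      have : a < y + k * m ∧ y + k * m < c ∧ y + k * m - (y - x) < a := by
        by_contra h; rw [if_neg h] at hk; exact hk rfl
      unfold crs; rw [if_pos (by omega)]; exact one_ne_zero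
  · intro p hp
    rw [if_neg]; intro h; exact hp (Finset.mem_Ioo.2 ⟨h.1, h.2.1⟩)
  · intro p hp
    rw [if_neg]; intro h; exact hp (Finset.mem_Ioo.2 ⟨h.1, h.2.1⟩)

/-! ## Part 2: labelled triangulations -/

/-- A labelled family of arcs `(x i, y i)` with an apex `β i` each and a marked loop `δ`. -/
structure ArcSys (n : ℕ) where
  x : Fin n → ℤ
  y : Fin n → ℤ
  β : Fin n → ℤ
  δ : Fin n

/-- The arcs form a triangulation (binary tree) of the window `[x δ, x δ + m]`. -/
structure ArcSys.Valid {n : ℕ} (m : ℤ) (S : ArcSys n) : Prop where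
  hxβ : ∀ j, S.x j < S.β j
  hβy : ∀ j, S.β j < S.y j
  hδ : S.y S.δ = S.x S.δ + m
  hwx : ∀ j, S.x S.δ ≤ S.x j
  hwy : ∀ j, S.y j ≤ S.y S.δ
  hL : ∀ j, S.β j = S.x j + 1 ∨ ∃ i, S.x i = S.x j ∧ S.y i = S.β j
  hR : ∀ j, S.y j = S.β j + 1 ∨ ∃ i, S.x i = S.β j ∧ S.y i = S.y j
  hC : ∀ i j, i ≠ j → S.y i ≤ S.x j ∨ S.y j ≤ S.x i ∨
    (S.x j ≤ S.x i ∧ S.y i ≤ S.β j) ∨ (S.β j ≤ S.x i ∧ S.y i ≤ S.y j) ∨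
    (S.x i ≤ S.x j ∧ S.y j ≤ S.β i) ∨ (S.β i ≤ S.x j ∧ S.y j ≤ S.y i)

/-- `S'` is obtained from `S` by flipping `k`, the left child of `l`. -/
structure FlipL {n : ℕ} (S S' : ArcSys n) (k l : Fin n) : Prop where
  hkl : k ≠ l
  hk : k ≠ S.δ
  hδ : S'.δ = S.δ
  hx : S.x k = S.x l
  hy : S.y k = S.β l
  x'k : S'.x k = S.β k
  y'k : S'.y k = S.y l
  β'k : S'.β k = S.y k
  β'l : S'.β l = S.β k
  x'o : ∀ j, j ≠ k → S'.x j = S.x j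
  y'o : ∀ j, j ≠ k → S'.y j = S.y j
  β'o : ∀ j, j ≠ k → j ≠ l → S'.β j = S.β j

lemma FlipL.valid {n : ℕ} {m : ℤ} {S S' : ArcSys n} {k l : Fin n} (F : FlipL S S' k l)
    (V : S.Valid m) : S'.Valid m := by
  obtain ⟨hkl, hk, hδ', hx, hy, x'k, y'k, β'k, β'l, x'o, y'o, β'o⟩ := F
  have xl := x'o l hkl.symm
  have yl := y'o l hkl.symm
  have a1 := V.hxβ k
  have a2 := V.hβy k
  have a3 := V.hxβ l
  have a4 := V.hβy l
  have xd := x'o S.δ hk.symm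
  have yd := y'o S.δ hk.symm
  refine ⟨?_, ?_, ?_, ?_, ?_, ?_, ?_, ?_⟩
  · intro j
    by_cases jk : j = k
    · subst jk; omega
    by_cases jl : j = l
    · subst jl; omega
    have := V.hxβ j; rw [x'o j jk, β'o j jk jl]; exact this
  · intro j
    by_cases jk : j = k
    · subst jk; omega
    by_cases jl : j = l
    · subst jl; omega
    have := V.hβy j; rw [y'o j jk, β'o j jk jl]; exact this
  · rw [hδ', xd, yd]; exact V.hδ
  · intro j
    rw [hδ', xd]
    by_cases jk : j = k
    · subst jk; have := V.hwx j; omega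
    · rw [x'o j jk]; exact V.hwx j
  · intro j
    rw [hδ', yd]
    by_cases jk : j = k
    · subst jk; have := V.hwy l; omega
    · rw [y'o j jk]; exact V.hwy j
  · intro j
    by_cases jk : j = k
    · subst jk
      rcases V.hR j with h | ⟨i, h1, h2⟩
      · left; omega
      · right
        have ij : i ≠ j := by rintro rfl; omega
        exact ⟨i, by rw [x'o i ij]; omega, by rw [y'o i ij]; omega⟩
    by_cases jl : j = l
    · subst jl
      rcases V.hL k with h | ⟨i, h1, h2⟩
      · left; omega
      · right
        have ij : i ≠ k := by rintro rfl; omega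
        exact ⟨i, by rw [x'o i ij]; omega, by rw [y'o i ij]; omega⟩
    rw [x'o j jk, β'o j jk jl]
    rcases V.hL j with h | ⟨i, h1, h2⟩
    · left; exact h
    · right
      have ij : i ≠ k := by
        rintro rfl
        have := V.hC j l jl
        have := V.hxβ j
        have := V.hβy j
        omega
      exact ⟨i, by rw [x'o i ij]; omega, by rw [y'o i ij]; omega⟩
  · intro j
    by_cases jk : j = k
    · subst jk
      rcases V.hR l with h | ⟨i, h1, h2⟩
      · left; omega
      · right
        have ij : i ≠ j := by rintro rfl; omega
        exact ⟨i, by rw [x'o i ij]; omega, by rw [y'o i ij]; omega⟩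
    by_cases jl : j = l
    · subst jl
      right; exact ⟨k, by omega, by omega⟩
    rw [y'o j jk, β'o j jk jl]
    rcases V.hR j with h | ⟨i, h1, h2⟩
    · left; exact h
    · right
      have ij : i ≠ k := by
        rintro rfl
        have := V.hC j l jl
        have := V.hxβ j
        have := V.hβy j
        omega
      exact ⟨i, by rw [x'o i ij]; omega, by rw [y'o i ij]; omega⟩
  · have key : ∀ i, i ≠ k → S'.y i ≤ S'.x k ∨ S'.y k ≤ S'.x i ∨
      (S'.x k ≤ S'.x i ∧ S'.y i ≤ S'.β k) ∨ (S'.β k ≤ S'.x i ∧ S'.y i ≤ S'.y k) ∨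
      (S'.x i ≤ S'.x k ∧ S'.y k ≤ S'.β i) ∨ (S'.β i ≤ S'.x k ∧ S'.y k ≤ S'.y i) := by
      intro i ik
      by_cases il : i = l
      · subst il; omega
      have c1 := V.hC i k ik
      have c2 := V.hC i l il
      have := V.hxβ i
      have := V.hβy i
      rw [x'o i ik, y'o i ik, β'o i ik il, x'k, y'k, β'k]
      omega
    have key2 : ∀ i, i ≠ k → i ≠ l → S'.y i ≤ S'.x l ∨ S'.y l ≤ S'.x i ∨
      (S'.x l ≤ S'.x i ∧ S'.y i ≤ S'.β l) ∨ (S'.β l ≤ S'.x i ∧ S'.y i ≤ S'.y l) ∨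
      (S'.x i ≤ S'.x l ∧ S'.y l ≤ S'.β i) ∨ (S'.β i ≤ S'.x l ∧ S'.y l ≤ S'.y i) := by
      intro i ik il
      have c1 := V.hC i k ik
      have c2 := V.hC i l il
      have := V.hxβ i
      have := V.hβy i
      rw [x'o i ik, y'o i ik, β'o i ik il, xl, yl, β'l]
      omega
    intro i j hij
    by_cases jk : j = k
    · subst jk; exact key i hij
    by_cases ik : i = k
    · subst ik; have := key j jk; omega
    by_cases jl : j = l
    · subst jl; exact key2 i ik hij
    by_cases il : i = l
    · subst il; have := key2 j jk jl; omega
    rw [x'o i ik, y'o i ik, β'o i ik il, x'o j jk, y'o j jk, β'o j jk jl]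
    exact V.hC i j hij

lemma FlipL.valid_rev {n : ℕ} {m : ℤ} {S S' : ArcSys n} {k l : Fin n} (F : FlipL S S' k l)
    (V : S'.Valid m) : S.Valid m := by
  obtain ⟨hkl, hk, hδ', hx, hy, x'k, y'k, β'k, β'l, x'o, y'o, β'o⟩ := F
  have xl := x'o l hkl.symm
  have yl := y'o l hkl.symm
  have a1 := V.hxβ k
  have a2 := V.hβy k
  have a3 := V.hxβ l
  have a4 := V.hβy l
  have xd := x'o S.δ hk.symm
  have yd := y'o S.δ hk.symm
  refine ⟨?_, ?_, ?_, ?_, ?_, ?_, ?_, ?_⟩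
  · intro j
    by_cases jk : j = k
    · subst jk; omega
    by_cases jl : j = l
    · subst jl; omega
    have := V.hxβ j; rw [← x'o j jk, ← β'o j jk jl]; exact this
  · intro j
    by_cases jk : j = k
    · subst jk; omega
    by_cases jl : j = l
    · subst jl; omega
    have := V.hβy j; rw [← y'o j jk, ← β'o j jk jl]; exact this
  · rw [← xd, ← yd, ← hδ']; exact V.hδ
  · intro j
    rw [← xd, ← hδ']
    by_cases jk : j = k
    · subst jk; have := V.hwx l; omega
    · rw [← x'o j jk]; exact V.hwx j
  · intro j
    rw [← yd, ← hδ']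
    by_cases jk : j = k
    · subst jk; have := V.hwy j; omega
    · rw [← y'o j jk]; exact V.hwy j
  · intro j
    by_cases jk : j = k
    · subst jk
      rcases V.hL l with h | ⟨i, h1, h2⟩
      · left; omega
      · right
        have ij : i ≠ j := by rintro rfl; omega
        exact ⟨i, by rw [← x'o i ij]; omega, by rw [← y'o i ij]; omega⟩
    by_cases jl : j = l
    · subst jl
      right; exact ⟨k, by omega, by omega⟩
    rw [← x'o j jk, ← β'o j jk jl]
    rcases V.hL j with h | ⟨i, h1, h2⟩
    · left; exact h
    · right
      have ij : i ≠ k := by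
        rintro rfl
        have := V.hC j l jl
        have := V.hxβ j
        have := V.hβy j
        omega
      exact ⟨i, by rw [← x'o i ij]; omega, by rw [← y'o i ij]; omega⟩
  · intro j
    by_cases jk : j = k
    · subst jk
      rcases V.hL j with h | ⟨i, h1, h2⟩
      · left; omega
      · right
        have ij : i ≠ j := by rintro rfl; omega
        exact ⟨i, by rw [← x'o i ij]; omega, by rw [← y'o i ij]; omega⟩
    by_cases jl : j = l
    · subst jl
      rcases V.hR k with h | ⟨i, h1, h2⟩
      · left; omega
      · right
        have ij : i ≠ k := by rintro rfl; omega
        exact ⟨i, by rw [← x'o i ij]; omega, by rw [← y'o i ij]; omega⟩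
    rw [← y'o j jk, ← β'o j jk jl]
    rcases V.hR j with h | ⟨i, h1, h2⟩
    · left; exact h
    · right
      have ij : i ≠ k := by
        rintro rfl
        have := V.hC j l jl
        have := V.hxβ j
        have := V.hβy j
        omega
      exact ⟨i, by rw [← x'o i ij]; omega, by rw [← y'o i ij]; omega⟩
  · have key : ∀ i, i ≠ k → S.y i ≤ S.x k ∨ S.y k ≤ S.x i ∨
      (S.x k ≤ S.x i ∧ S.y i ≤ S.β k) ∨ (S.β k ≤ S.x i ∧ S.y i ≤ S.y k) ∨
      (S.x i ≤ S.x k ∧ S.y k ≤ S.β i) ∨ (S.β i ≤ S.x k ∧ S.y k ≤ S.y i) := by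
      intro i ik
      by_cases il : i = l
      · subst il; omega
      have c1 := V.hC i k ik
      have c2 := V.hC i l il
      have := V.hxβ i
      have := V.hβy i
      rw [x'o i ik, y'o i ik, β'o i ik il] at *
      omega
    have key2 : ∀ i, i ≠ k → i ≠ l → S.y i ≤ S.x l ∨ S.y l ≤ S.x i ∨
      (S.x l ≤ S.x i ∧ S.y i ≤ S.β l) ∨ (S.β l ≤ S.x i ∧ S.y i ≤ S.y l) ∨
      (S.x i ≤ S.x l ∧ S.y l ≤ S.β i) ∨ (S.β i ≤ S.x l ∧ S.y l ≤ S.y i) := by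
      intro i ik il
      have c1 := V.hC i k ik
      have c2 := V.hC i l il
      have := V.hxβ i
      have := V.hβy i
      have e1 := x'o i ik
      have e2 := y'o i ik
      have e3 := β'o i ik il
      omega
    intro i j hij
    by_cases jk : j = k
    · subst jk; exact key i hij
    by_cases ik : i = k
    · subst ik; have := key j jk; omega
    by_cases jl : j = l
    · subst jl; exact key2 i ik hij
    by_cases il : i = l
    · subst il; have := key2 j jk jl; omega
    rw [← x'o i ik, ← y'o i ik, ← β'o i ik il, ← x'o j jk, ← y'o j jk, ← β'o j jk jl]
    exact V.hC i j hij

/-! ### Existence of flips -/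

lemma ArcSys.Valid.exists_parent {n : ℕ} {m : ℤ} {S : ArcSys n} (V : S.Valid m) {k : Fin n}
    (hk : k ≠ S.δ) : ∃ l, k ≠ l ∧ ((S.x k = S.x l ∧ S.y k = S.β l) ∨ (S.x k = S.β l ∧ S.y k = S.y l)) := by
  classical
  obtain ⟨l, hl, hmin⟩ := Finset.exists_min_image
    (Finset.univ.filter fun l => l ≠ k ∧ S.x l ≤ S.x k ∧ S.y k ≤ S.y l) (fun l => S.y l - S.x l)
    ⟨S.δ, by simp only [Finset.mem_filter, Finset.mem_univ, true_and]
             exact ⟨hk.symm, V.hwx k, V.hwy k⟩⟩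
  simp only [Finset.mem_filter, Finset.mem_univ, true_and] at hl hmin
  refine ⟨l, hl.1.symm, ?_⟩
  have c := V.hC k l hl.1.symm
  have := V.hxβ k
  have := V.hβy k
  have := V.hxβ l
  have := V.hβy l
  have c' : (S.x l ≤ S.x k ∧ S.y k ≤ S.β l) ∨ (S.β l ≤ S.x k ∧ S.y k ≤ S.y l) := by omega
  rcases c' with c' | c'
  · left
    rcases V.hL l with h | ⟨i, h1, h2⟩
    · omega
    · by_cases ik : i = k
      · subst ik; exact ⟨h1, h2⟩
      · have := hmin i ⟨ik, by omega, by omega⟩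
        omega
  · right
    rcases V.hR l with h | ⟨i, h1, h2⟩
    · omega
    · by_cases ik : i = k
      · subst ik; exact ⟨h1, h2⟩
      · have := hmin i ⟨ik, by omega, by omega⟩
        omega

lemma ArcSys.Valid.exists_flip {n : ℕ} {m : ℤ} {S : ArcSys n} (V : S.Valid m) {k : Fin n}
    (hk : k ≠ S.δ) : ∃ S' l, FlipL S S' k l ∨ FlipL S' S k l := by
  obtain ⟨l, hkl, h | h⟩ := V.exists_parent hk
  · refine ⟨⟨Function.update S.x k (S.β k), Function.update S.y k (S.y l),
      Function.update (Function.update S.β k (S.y k)) l (S.β k), S.δ⟩, l, Or.inl ?_⟩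
    constructor <;> first | assumption | rfl | skip
    · exact h.1
    · exact h.2
    · simp
    · simp
    · simp [hkl]
    · simp
    · intro j hj; simp [hj]
    · intro j hj; simp [hj]
    · intro j hj hj'; simp [hj, hj']
  · refine ⟨⟨Function.update S.x k (S.x l), Function.update S.y k (S.β k),
      Function.update (Function.update S.β k (S.x k)) l (S.β k), S.δ⟩, l, Or.inr ?_⟩
    constructor <;> first | assumption | rfl | skip
    · simp [hkl.symm]
    · simp
    · simp [hkl]
    · simp [hkl.symm, h.2]
    · simp
    · simp [hkl, h.1]
    · intro j hj; simp [hj]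
    · intro j hj; simp [hj]
    · intro j hj hj'; simp [hj, hj']

/-- `S'` is obtained from `S` by flipping the loop. -/
structure FlipRoot {n : ℕ} (m : ℤ) (S S' : ArcSys n) : Prop where
  hδ : S'.δ = S.δ
  x'd : S'.x S.δ = S.β S.δ
  y'd : S'.y S.δ = S.β S.δ + m
  β'd : S'.β S.δ = S.y S.δ
  lo : ∀ j, j ≠ S.δ → S.y j ≤ S.β S.δ →
    S'.x j = S.x j + m ∧ S'.y j = S.y j + m ∧ S'.β j = S.β j + m
  hi : ∀ j, j ≠ S.δ → S.β S.δ ≤ S.x j → S'.x j = S.x j ∧ S'.y j = S.y j ∧ S'.β j = S.β j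

lemma ArcSys.Valid.side {n : ℕ} {m : ℤ} {S : ArcSys n} (V : S.Valid m) {j : Fin n}
    (hj : j ≠ S.δ) : S.y j ≤ S.β S.δ ∨ S.β S.δ ≤ S.x j := by
  have := V.hC j S.δ hj
  have := V.hwx j
  have := V.hwy j
  have := V.hxβ j
  have := V.hβy j
  have := V.hxβ S.δ
  have := V.hβy S.δ
  omega

lemma ArcSys.Valid.exists_flipRoot {n : ℕ} {m : ℤ} {S : ArcSys n} (V : S.Valid m) :
    ∃ S', FlipRoot m S S' := by
  refine ⟨⟨Function.update (fun j => if S.y j ≤ S.β S.δ then S.x j + m else S.x j) S.δ (S.β S.δ),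
    Function.update (fun j => if S.y j ≤ S.β S.δ then S.y j + m else S.y j) S.δ (S.β S.δ + m),
    Function.update (fun j => if S.y j ≤ S.β S.δ then S.β j + m else S.β j) S.δ (S.y S.δ),
    S.δ⟩, ?_⟩
  constructor
  · rfl
  · simp
  · simp
  · simp
  · intro j hj h; simp [hj, h]
  · intro j hj h
    have h' : ¬ S.y j ≤ S.β S.δ := by
      have := V.hxβ j
      have := V.hβy j
      omega
    simp [hj, h']

lemma FlipRoot.valid {n : ℕ} {m : ℤ} {S S' : ArcSys n} (F : FlipRoot m S S')
    (V : S.Valid m) : S'.Valid m := by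
  obtain ⟨hδ', x'd, y'd, β'd, lo, hi⟩ := F
  have a1 := V.hxβ S.δ
  have a2 := V.hβy S.δ
  have a3 := V.hδ
  refine ⟨?_, ?_, ?_, ?_, ?_, ?_, ?_, ?_⟩
  · intro j
    by_cases jd : j = S.δ
    · subst jd; omega
    have := V.hxβ j
    rcases V.side jd with h | h
    · have := lo j jd h; omega
    · have := hi j jd h; omega
  · intro j
    by_cases jd : j = S.δ
    · subst jd; omega
    have := V.hβy j
    rcases V.side jd with h | h
    · have := lo j jd h; omega
    · have := hi j jd h; omega
  · rw [hδ']; omega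
  · intro j
    rw [hδ']
    by_cases jd : j = S.δ
    · subst jd; omega
    have := V.hwx j
    rcases V.side jd with h | h
    · have := lo j jd h; omega
    · have := hi j jd h; omega
  · intro j
    rw [hδ']
    by_cases jd : j = S.δ
    · subst jd; omega
    have := V.hwy j
    rcases V.side jd with h | h
    · have := lo j jd h; omega
    · have := hi j jd h; omega
  · intro j
    by_cases jd : j = S.δ
    · subst jd
      rcases V.hR S.δ with h | ⟨i, h1, h2⟩
      · left; omega
      · right
        have id : i ≠ S.δ := by rintro rfl; omega
        have := hi i id (by omega)
        exact ⟨i, by omega, by omega⟩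
    have p1 := V.hxβ j
    have p2 := V.hβy j
    have w1 := V.hwx j
    have w2 := V.hwy j
    rcases V.side jd with h | h
    · have e := lo j jd h
      rcases V.hL j with h | ⟨i, h1, h2⟩
      · left; omega
      · right
        have id : i ≠ S.δ := by rintro rfl; omega
        have := lo i id (by omega)
        exact ⟨i, by omega, by omega⟩
    · have e := hi j jd h
      rcases V.hL j with h | ⟨i, h1, h2⟩
      · left; omega
      · right
        have id : i ≠ S.δ := by rintro rfl; omega
        have := hi i id (by omega)
        exact ⟨i, by omega, by omega⟩
  · intro j
    by_cases jd : j = S.δ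
    · subst jd
      rcases V.hL S.δ with h | ⟨i, h1, h2⟩
      · left; omega
      · right
        have id : i ≠ S.δ := by rintro rfl; omega
        have := lo i id (by omega)
        exact ⟨i, by omega, by omega⟩
    have p1 := V.hxβ j
    have p2 := V.hβy j
    have w1 := V.hwx j
    have w2 := V.hwy j
    rcases V.side jd with h | h
    · have e := lo j jd h
      rcases V.hR j with h | ⟨i, h1, h2⟩
      · left; omega
      · right
        have id : i ≠ S.δ := by rintro rfl; omega
        have := lo i id (by omega)
        exact ⟨i, by omega, by omega⟩
    · have e := hi j jd h
      rcases V.hR j with h | ⟨i, h1, h2⟩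
      · left; omega
      · right
        have id : i ≠ S.δ := by rintro rfl; omega
        have := hi i id (by omega)
        exact ⟨i, by omega, by omega⟩
  · have key : ∀ i, i ≠ S.δ → 
      (S'.x S.δ ≤ S'.x i ∧ S'.y i ≤ S'.β S.δ) ∨ (S'.β S.δ ≤ S'.x i ∧ S'.y i ≤ S'.y S.δ) := by
      intro i id
      have w1 := V.hwx i
      have w2 := V.hwy i
      rcases V.side id with h | h
      · have e := lo i id h; omega
      · have e := hi i id h; omega
    intro i j hij
    by_cases id : i = S.δ
    · subst id; have := key j hij.symm; omega
    by_cases jd : j = S.δ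
    · subst jd; have := key i hij; omega
    have c := V.hC i j hij
    have w1 := V.hwx i
    have w2 := V.hwy i
    have w3 := V.hwx j
    have w4 := V.hwy j
    rcases V.side id with h | h <;> rcases V.side jd with h' | h'
    · have := lo i id h; have := lo j jd h'; omega
    · have := lo i id h; have := hi j jd h'; omega
    · have := hi i id h; have := lo j jd h'; omega
    · have := hi i id h; have := hi j jd h'; omega

/-! ### The exchange matrix of a triangulation -/

section ExchangeMatrix

variable {n : ℕ}

/-- indicator: `i` is the left side of the triangle `t` -/
def lc (S : ArcSys n) (i t : Fin n) : ℤ := if S.x i = S.x t ∧ S.y i = S.β t then 1 else 0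

/-- indicator: `i` is the right side of the triangle `t` -/
def rc (S : ArcSys n) (i t : Fin n) : ℤ := if S.x i = S.β t ∧ S.y i = S.y t then 1 else 0

/-- indicator: `i` is the base of the triangle `t` -/
def dl (i t : Fin n) : ℤ := if i = t then 1 else 0

/-- contribution of the triangle `t` -/
def triQ (S : ArcSys n) (t i j : Fin n) : ℤ :=
  (lc S i t * rc S j t + rc S i t * dl j t + dl i t * lc S j t) -
  (lc S j t * rc S i t + rc S j t * dl i t + dl j t * lc S i t)

def quivQ (S : ArcSys n) (i j : Fin n) : ℤ := ∑ t, triQ S t i j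

/-- The weight of an arc: loops have weight two. -/
def wt (S : ArcSys n) (i : Fin n) : ℤ := if i = S.δ then 2 else 1

def exMat (S : ArcSys n) : Matrix (Fin n) (Fin n) ℤ := fun i j => wt S i * quivQ S i j

lemma triQ_self (S : ArcSys n) (t i : Fin n) : triQ S t i i = 0 := by unfold triQ; ring

lemma triQ_anti (S : ArcSys n) (t i j : Fin n) : triQ S t i j = - triQ S t j i := by unfold triQ; ring

lemma quivQ_anti (S : ArcSys n) (i j : Fin n) : quivQ S i j = - quivQ S j i := by
  unfold quivQ; rw [← Finset.sum_neg_distrib]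
  exact Finset.sum_congr rfl fun t _ => triQ_anti S t i j

lemma quivQ_self (S : ArcSys n) (i : Fin n) : quivQ S i i = 0 := by
  have := quivQ_anti S i i; omega

/-- Column `k` of the matrix, `k` a left child of `l`. -/
lemma quivQ_col {m : ℤ} {S S' : ArcSys n} {k l : Fin n} (F : FlipL S S' k l) (V : S.Valid m)
    (i : Fin n) (hik : i ≠ k) :
    quivQ S i k = rc S i k + dl i l - lc S i k - rc S i l := by
  have nl : ∀ t, t ≠ k → t ≠ l → lc S k t = 0 ∧ rc S k t = 0 := by
    intro t tk tl
    have c := V.hC t l tl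
    have c2 := V.hC t k tk
    have := V.hxβ t
    have := V.hβy t
    have := V.hxβ l
    have := V.hβy l
    have := F.hx
    have := F.hy
    unfold lc rc
    constructor <;> rw [if_neg (by omega)]
  have hkl := F.hkl
  have b1 := V.hxβ k
  have b2 := V.hβy k
  have b3 := V.hxβ l
  have b4 := V.hβy l
  have v1 : lc S k k = 0 := by unfold lc; rw [if_neg (by omega)]
  have v2 : rc S k k = 0 := by unfold rc; rw [if_neg (by omega)]
  have v3 : lc S k l = 1 := by unfold lc; rw [if_pos ⟨F.hx, F.hy⟩]
  have v4 : rc S k l = 0 := by unfold rc; have := F.hx; rw [if_neg (by omega)]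
  have v5 : dl k k = 1 := by simp [dl]
  have v6 : dl k l = 0 := by simp [dl, hkl]
  have v7 : dl i k = 0 := by simp [dl, hik]
  unfold quivQ
  rw [← Finset.add_sum_erase _ _ (Finset.mem_univ k), ← Finset.add_sum_erase _ _
    (Finset.mem_erase.2 ⟨hkl.symm, Finset.mem_univ l⟩), Finset.sum_eq_zero]
  · unfold triQ
    rw [v1, v2, v3, v4, v5, v6, v7]; ring
  · intro t ht
    simp only [Finset.mem_erase, Finset.mem_univ, and_true] at ht
    have := nl t ht.2 ht.1
    have v8 : dl k t = 0 := by simp [dl, Ne.symm ht.2]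
    unfold triQ
    rw [this.1, this.2, v8]; ring

end ExchangeMatrix

/-! ### Flips mutate the exchange matrix -/

section FlipMatrix

variable {n : ℕ}

lemma mut_arith (w u v u' v' : ℤ) (hw : w = 1 ∨ w = 2)
    (h : (u = 0 ∧ v = 0) ∨ (u = 1 ∧ v = 0) ∨ (u = 0 ∧ v = 1))
    (h' : (u' = 0 ∧ v' = 0) ∨ (u' = 1 ∧ v' = 0) ∨ (u' = 0 ∧ v' = 1)) (c : ℤ) (hc : c = 1 ∨ c = 2) :
    w * (c * (u * v' - v * u')) = (w * (u - v)).sign * max (w * (u - v) * (c * (v' - u'))) 0 := by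
  rcases hw with rfl | rfl <;> rcases hc with rfl | rfl <;>
  rcases h with ⟨rfl, rfl⟩ | ⟨rfl, rfl⟩ | ⟨rfl, rfl⟩ <;>
  rcases h' with ⟨rfl, rfl⟩ | ⟨rfl, rfl⟩ | ⟨rfl, rfl⟩ <;> rfl

lemma lcrc_eq_zero {m : ℤ} {S : ArcSys n} {k l : Fin n} (V : S.Valid m)
    (h : (S.x k = S.x l ∧ S.y k = S.β l) ∨ (S.x k = S.β l ∧ S.y k = S.y l))
    (t : Fin n) (tk : t ≠ k) (tl : t ≠ l) : lc S k t = 0 ∧ rc S k t = 0 := by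
  have c := V.hC t l tl
  have c2 := V.hC t k tk
  have := V.hxβ t
  have := V.hβy t
  have := V.hxβ l
  have := V.hβy l
  unfold lc rc
  constructor <;> rw [if_neg (by omega)]

lemma wt_cases (S : ArcSys n) (i : Fin n) : wt S i = 1 ∨ wt S i = 2 := by
  unfold wt; split_ifs <;> simp

lemma FlipL.exMat_eq {m : ℤ} {S S' : ArcSys n} {k l : Fin n} (F : FlipL S S' k l)
    (V : S.Valid m) : exMat S' = mutMat k (exMat S) := by
  have V' := F.valid V
  have hkl := F.hkl
  have b1 := V.hxβ k
  have b2 := V.hβy k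
  have b3 := V.hxβ l
  have b4 := V.hβy l
  have e1 := F.hx
  have e2 := F.hy
  have e3 := F.x'k
  have e4 := F.y'k
  have e5 := F.β'k
  have e6 := F.β'l
  have e7 := F.x'o l hkl.symm
  have e8 := F.y'o l hkl.symm
  have r1 : ∀ i, i ≠ k → lc S' i k = rc S i k := by
    intro i hi
    unfold lc rc
    rw [F.x'o i hi, F.y'o i hi, e3, e5]
  have r2 : ∀ i, i ≠ k → rc S' i k = rc S i l := by
    intro i hi
    unfold rc
    rw [F.x'o i hi, F.y'o i hi, e4, e5, e2]
  have r3 : ∀ i, i ≠ k → lc S' i l = lc S i k := by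
    intro i hi
    unfold lc
    rw [F.x'o i hi, F.y'o i hi, e6, e7, e1]
  have r4 : ∀ i, i ≠ k → rc S' i l = 0 := by
    intro i hi
    have := V.hC i k hi
    have := V.hxβ i
    have := V.hβy i
    unfold rc
    rw [F.x'o i hi, F.y'o i hi, e6, e8, if_neg]
    omega
  have r5 : ∀ i, i ≠ k → lc S i l = 0 := by
    intro i hi
    have := V.hC i k hi
    have := V.hxβ i
    have := V.hβy i
    unfold lc
    rw [if_neg]
    omega
  have same : ∀ t, t ≠ k → t ≠ l → ∀ i j, triQ S' t i j = triQ S t i j := by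
    intro t tk tl
    have z := lcrc_eq_zero V (Or.inl ⟨F.hx, F.hy⟩) t tk tl
    have z' := lcrc_eq_zero V' (k := k) (l := l) (Or.inr ⟨by omega, by omega⟩) t tk tl
    have hh : ∀ i, lc S' i t = lc S i t ∧ rc S' i t = rc S i t := by
      intro i
      by_cases ik : i = k
      · subst ik; rw [z.1, z.2]; exact z'
      · unfold lc rc
        rw [F.x'o i ik, F.y'o i ik, F.x'o t tk, F.y'o t tk, F.β'o t tk tl]
        exact ⟨rfl, rfl⟩
    intro i j
    unfold triQ
    rw [(hh i).1, (hh i).2, (hh j).1, (hh j).2]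
  have dec : ∀ U : ArcSys n, ∀ i j, quivQ U i j = triQ U k i j + (triQ U l i j +
      ∑ t ∈ (Finset.univ.erase k).erase l, triQ U t i j) := by
    intro U i j
    unfold quivQ
    rw [← Finset.add_sum_erase _ _ (Finset.mem_univ k), ← Finset.add_sum_erase _ _
      (Finset.mem_erase.2 ⟨hkl.symm, Finset.mem_univ l⟩)]
  have diff : ∀ i j, quivQ S' i j = quivQ S i j + (triQ S' k i j + triQ S' l i j
      - triQ S k i j - triQ S l i j) := by
    intro i j
    rw [dec S', dec S, Finset.sum_congr rfl (g := fun t => triQ S t i j)]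
    · ring
    · intro t ht
      simp only [Finset.mem_erase, Finset.mem_univ, and_true] at ht
      exact same t ht.2 ht.1 i j
  have col' : ∀ i, i ≠ k → quivQ S' i k = - quivQ S i k := by
    intro i hi
    have v1 : lc S k k = 0 := by unfold lc; rw [if_neg (by omega)]
    have v2 : rc S k k = 0 := by unfold rc; rw [if_neg (by omega)]
    have v3 : lc S k l = 1 := by unfold lc; rw [if_pos ⟨F.hx, F.hy⟩]
    have v4 : rc S k l = 0 := by unfold rc; have := F.hx; rw [if_neg (by omega)]
    have u1 : lc S' k k = 0 := by unfold lc; rw [if_neg (by omega)]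
    have u2 : rc S' k k = 0 := by unfold rc; rw [if_neg (by omega)]
    have u3 : lc S' k l = 0 := by unfold lc; rw [if_neg (by omega)]
    have u4 : rc S' k l = 1 := by unfold rc; rw [if_pos (by omega)]
    have v5 : dl k k = 1 := by simp [dl]
    have v6 : dl k l = 0 := by simp [dl, hkl]
    have v7 : dl i k = 0 := by simp [dl, hi]
    rw [diff, quivQ_col F V i hi]
    unfold triQ
    rw [r1 i hi, r2 i hi, r3 i hi, r4 i hi, r5 i hi, v1, v2, v3, v4, v5, v6, v7, u1, u2, u3, u4]
    ring
  have wk : wt S k = 1 := by unfold wt; rw [if_neg F.hk]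
  have wS : ∀ i, wt S' i = wt S i := by intro i; unfold wt; rw [F.hδ]
  ext i j
  unfold mutMat exMat
  rw [wS i]
  by_cases h : i = k ∨ j = k
  · rw [if_pos h]
    by_cases hi : i = k
    · subst hi
      by_cases hj : j = i
      · subst hj; rw [quivQ_self, quivQ_self]; ring
      · rw [quivQ_anti S', quivQ_anti S, col' j hj]; ring
    · obtain rfl : j = k := by tauto
      rw [col' i hi]; ring
  · rw [if_neg h]
    push Not at h
    obtain ⟨hi, hj⟩ := h
    rw [wk, quivQ_col F V i hi, quivQ_anti S k j, quivQ_col F V j hj, diff]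
    have cs : ∀ i, i ≠ k → (rc S i k + dl i l = 0 ∧ lc S i k + rc S i l = 0) ∨
        (rc S i k + dl i l = 1 ∧ lc S i k + rc S i l = 0) ∨
        (rc S i k + dl i l = 0 ∧ lc S i k + rc S i l = 1) := by
      intro i hi
      unfold rc lc dl
      by_cases il : i = l
      · subst il
        rw [if_pos rfl]
        split_ifs <;> first | omega | (exfalso; omega)
      · rw [if_neg il]
        split_ifs <;> first | omega | (exfalso; omega)
    have vi : dl i k = 0 := by simp [dl, hi]
    have vj : dl j k = 0 := by simp [dl, hj]
    have key := mut_arith (wt S i) _ _ _ _ (wt_cases S i) (cs i hi) (cs j hj) 1 (Or.inl rfl)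
    have e : rc S i k + dl i l - lc S i k - rc S i l = rc S i k + dl i l - (lc S i k + rc S i l) := by
      ring
    have e' : wt S i * (rc S i k + dl i l - lc S i k - rc S i l) *
      (1 * -(rc S j k + dl j l - lc S j k - rc S j l)) = wt S i * (rc S i k + dl i l - (lc S i k + rc S i l)) *
      (1 * (lc S j k + rc S j l - (rc S j k + dl j l))) := by
      ring
    rw [e', e, ← key]
    unfold triQ
    rw [r1 i hi, r2 i hi, r3 i hi, r4 i hi, r5 i hi, r1 j hj, r2 j hj, r3 j hj, r4 j hj, r5 j hj, vi, vj]
    ring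

lemma mutMat_mutMat (k : Fin n) (B : Matrix (Fin n) (Fin n) ℤ) : mutMat k (mutMat k B) = B := by
  ext i j
  by_cases h : i = k ∨ j = k
  · simp [mutMat, h]
  · have h' := h
    push Not at h'
    simp [mutMat, h, h'.1, h'.2]

lemma quivQ_root {m : ℤ} {S : ArcSys n} (V : S.Valid m) (i : Fin n) (hi : i ≠ S.δ) :
    quivQ S i S.δ = rc S i S.δ - lc S i S.δ := by
  have b1 := V.hxβ S.δ
  have b2 := V.hβy S.δ
  unfold quivQ
  rw [← Finset.add_sum_erase _ _ (Finset.mem_univ S.δ), Finset.sum_eq_zero]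
  · have v1 : lc S S.δ S.δ = 0 := by unfold lc; rw [if_neg (by omega)]
    have v2 : rc S S.δ S.δ = 0 := by unfold rc; rw [if_neg (by omega)]
    have v3 : dl S.δ S.δ = 1 := by simp [dl]
    have v4 : dl i S.δ = 0 := by simp [dl, hi]
    unfold triQ
    rw [v1, v2, v3, v4]; ring
  · intro t ht
    have ht : t ≠ S.δ := Finset.ne_of_mem_erase ht
    have := V.hxβ t
    have := V.hβy t
    have := V.hwx t
    have := V.hwy t
    have v1 : lc S S.δ t = 0 := by unfold lc; rw [if_neg (by omega)]
    have v2 : rc S S.δ t = 0 := by unfold rc; rw [if_neg (by omega)]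
    have v3 : dl S.δ t = 0 := by simp [dl, ht.symm]
    unfold triQ
    rw [v1, v2, v3]; ring

lemma FlipRoot.lcrc {m : ℤ} {S S' : ArcSys n} (F : FlipRoot m S S') (V : S.Valid m)
    (i : Fin n) (hi : i ≠ S.δ) :
    lc S' i S.δ = rc S i S.δ ∧ rc S' i S.δ = lc S i S.δ := by
  have b1 := V.hxβ S.δ
  have b2 := V.hβy S.δ
  have b3 := V.hxβ i
  have b4 := V.hβy i
  have b5 := V.hwx i
  have b6 := V.hwy i
  have e1 := F.x'd
  have e2 := F.y'd
  have e3 := F.β'd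
  have e4 := V.hδ
  unfold lc rc
  rcases V.side hi with h | h
  · have := F.lo i hi h
    constructor
    · rw [if_neg (by omega), if_neg (by omega)]
    · split_ifs <;> first | rfl | (exfalso; omega)
  · have := F.hi i hi h
    constructor
    · split_ifs <;> first | rfl | (exfalso; omega)
    · rw [if_neg (by omega), if_neg (by omega)]

lemma FlipRoot.exMat_eq {m : ℤ} {S S' : ArcSys n} (F : FlipRoot m S S')
    (V : S.Valid m) : exMat S' = mutMat S.δ (exMat S) := by
  have V' := F.valid V
  have b1 := V.hxβ S.δ
  have b2 := V.hβy S.δ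
  have e1 := F.x'd
  have e2 := F.y'd
  have e3 := F.β'd
  have e4 := V.hδ
  have same : ∀ t, t ≠ S.δ → ∀ i j, triQ S' t i j = triQ S t i j := by
    intro t ht
    have hh : ∀ i, lc S' i t = lc S i t ∧ rc S' i t = rc S i t := by
      intro i
      have c1 := V.hxβ t
      have c2 := V.hβy t
      have c3 := V.hwx t
      have c4 := V.hwy t
      have d3 := V.hwx i
      have d4 := V.hwy i
      have d1 := V.hxβ i
      have d2 := V.hβy i
      unfold lc rc
      by_cases hi : i = S.δ
      · subst hi
        rcases V.side ht with h | h
        · have := F.lo t ht h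
          constructor <;> rw [if_neg (by omega), if_neg (by omega)]
        · have := F.hi t ht h
          constructor <;> rw [if_neg (by omega), if_neg (by omega)]
      · rcases V.side ht with h | h <;> rcases V.side hi with h' | h'
        · obtain ⟨f1, f2, f3⟩ := F.lo t ht h
          obtain ⟨g1, g2, g3⟩ := F.lo i hi h'
          rw [f1, f2, f3, g1, g2]; simp
        · have f := F.lo t ht h
          have g := F.hi i hi h'
          constructor <;> rw [if_neg (by omega), if_neg (by omega)]
        · have f := F.hi t ht h
          have g := F.lo i hi h'
          constructor <;> rw [if_neg (by omega), if_neg (by omega)]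
        · obtain ⟨f1, f2, f3⟩ := F.hi t ht h
          obtain ⟨g1, g2, g3⟩ := F.hi i hi h'
          rw [f1, f2, f3, g1, g2]; simp
    intro i j
    unfold triQ
    rw [(hh i).1, (hh i).2, (hh j).1, (hh j).2]
  have diff : ∀ i j, quivQ S' i j = quivQ S i j + (triQ S' S.δ i j - triQ S S.δ i j) := by
    intro i j
    unfold quivQ
    rw [← Finset.add_sum_erase _ _ (Finset.mem_univ S.δ),
      ← Finset.add_sum_erase _ _ (Finset.mem_univ S.δ),
      Finset.sum_congr rfl (g := fun t => triQ S t i j)]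
    · ring
    · intro t ht
      exact same t (Finset.ne_of_mem_erase ht) i j
  have col' : ∀ i, i ≠ S.δ → quivQ S' i S.δ = - quivQ S i S.δ := by
    intro i hi
    have h := quivQ_root V' i (by rw [F.hδ]; exact hi)
    rw [F.hδ] at h
    rw [h, quivQ_root V i hi, (F.lcrc V i hi).1, (F.lcrc V i hi).2]; ring
  have wk : wt S S.δ = 2 := by unfold wt; rw [if_pos rfl]
  have wS : ∀ i, wt S' i = wt S i := by intro i; unfold wt; rw [F.hδ]
  ext i j
  unfold mutMat exMat
  rw [wS i]
  by_cases h : i = S.δ ∨ j = S.δ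
  · rw [if_pos h]
    by_cases hi : i = S.δ
    · rw [hi]
      by_cases hj : j = S.δ
      · rw [hj, quivQ_self, quivQ_self]; ring
      · rw [quivQ_anti S', quivQ_anti S, col' j hj]; ring
    · have : j = S.δ := by tauto
      rw [this, col' i hi]; ring
  · rw [if_neg h]
    push Not at h
    obtain ⟨hi, hj⟩ := h
    rw [wk, quivQ_root V i hi, quivQ_anti S S.δ j, quivQ_root V j hj, diff]
    have cs : ∀ i, i ≠ S.δ → (rc S i S.δ = 0 ∧ lc S i S.δ = 0) ∨
        (rc S i S.δ = 1 ∧ lc S i S.δ = 0) ∨ (rc S i S.δ = 0 ∧ lc S i S.δ = 1) := by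
      intro i hi
      unfold rc lc
      split_ifs <;> first | omega | (exfalso; omega)
    have vi : dl i S.δ = 0 := by simp [dl, hi]
    have vj : dl j S.δ = 0 := by simp [dl, hj]
    have key := mut_arith (wt S i) _ _ _ _ (wt_cases S i) (cs i hi) (cs j hj) 2 (Or.inr rfl)
    rw [neg_sub, ← key]
    unfold triQ
    rw [(F.lcrc V i hi).1, (F.lcrc V i hi).2, (F.lcrc V j hj).1, (F.lcrc V j hj).2, vi, vj]
    ring

/-- Every mutation of the matrix is realised by a flip. -/
lemma ArcSys.Valid.exists_mut {m : ℤ} {S : ArcSys n} (V : S.Valid m) (k : Fin n) :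
    ∃ S' : ArcSys n, S'.Valid m ∧ S'.δ = S.δ ∧ exMat S' = mutMat k (exMat S) ∧
      ((k = S.δ ∧ FlipRoot m S S') ∨ ∃ l, FlipL S S' k l ∨ FlipL S' S k l) := by
  by_cases hk : k = S.δ
  · obtain ⟨S', F⟩ := V.exists_flipRoot
    subst hk
    exact ⟨S', F.valid V, F.hδ, F.exMat_eq V, Or.inl ⟨rfl, F⟩⟩
  · obtain ⟨S', l, F | F⟩ := V.exists_flip hk
    · exact ⟨S', F.valid V, F.hδ, F.exMat_eq V, Or.inr ⟨l, Or.inl F⟩⟩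
    · have V' := F.valid_rev V
      refine ⟨S', V', F.hδ.symm, ?_, Or.inr ⟨l, Or.inr F⟩⟩
      rw [F.exMat_eq V', mutMat_mutMat]

end FlipMatrix

/-! ### Reaching a Dynkin seed -/

section Dynkin

variable {n : ℕ}

lemma skew_iff (B : Matrix (Fin n) (Fin n) ℤ) : SkewSymmetrizable B ↔
    ∃ d : Fin n → ℤ, (∀ i, 0 < d i) ∧ ∀ i j, d j * B j i = -(d i * B i j) := by
  unfold SkewSymmetrizable
  constructor
  · rintro ⟨d, hd, h⟩
    refine ⟨d, hd, fun i j => ?_⟩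
    have := congrFun (congrFun h i) j
    simpa [Matrix.diagonal_mul] using this
  · rintro ⟨d, hd, h⟩
    refine ⟨d, hd, ?_⟩
    ext i j
    simpa [Matrix.diagonal_mul] using h i j

lemma sign_max (x y : ℤ) : 2 * (x.sign * max (x * y) 0) = |x| * y + x * |y| := by
  rcases lt_trichotomy x 0 with hx | rfl | hx
  · rw [Int.sign_eq_neg_one_of_neg hx, abs_of_neg hx]
    rcases le_total y 0 with hy | hy
    · rw [abs_of_nonpos hy, max_eq_left (by nlinarith)]; ring
    · rw [abs_of_nonneg hy, max_eq_right (by nlinarith)]; ring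
  · simp
  · rw [Int.sign_eq_one_of_pos hx, abs_of_pos hx]
    rcases le_total y 0 with hy | hy
    · rw [abs_of_nonpos hy, max_eq_right (by nlinarith)]; ring
    · rw [abs_of_nonneg hy, max_eq_left (by nlinarith)]; ring

lemma skew_mut (k : Fin n) {B : Matrix (Fin n) (Fin n) ℤ} (h : SkewSymmetrizable B) :
    SkewSymmetrizable (mutMat k B) := by
  rw [skew_iff] at h ⊢
  obtain ⟨d, hd, h⟩ := h
  refine ⟨d, hd, fun i j => ?_⟩
  unfold mutMat
  by_cases hk : i = k ∨ j = k
  · rw [if_pos hk, if_pos hk.symm]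
    have := h i j
    linarith
  · rw [if_neg hk, if_neg (fun h => hk h.symm)]
    have s1 := sign_max (B j k) (B k i)
    have s2 := sign_max (B i k) (B k j)
    have h1 := h k j
    have h2 := h k i
    have h0 := h i j
    have a1 : d j * |B j k| = d k * |B k j| := by
      have := congrArg abs h1
      rwa [abs_neg, abs_mul, abs_mul, abs_of_pos (hd j), abs_of_pos (hd k)] at this
    have a2 : d i * |B i k| = d k * |B k i| := by
      have := congrArg abs h2
      rwa [abs_neg, abs_mul, abs_mul, abs_of_pos (hd i), abs_of_pos (hd k)] at this
    have key : d j * (|B j k| * B k i + B j k * |B k i|) +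
      d i * (|B i k| * B k j + B i k * |B k j|) = 0 := by
      linear_combination B k i * a1 + B k j * a2 + |B k i| * h1 + |B k j| * h2
    rw [← s1, ← s2] at key
    linarith

lemma skew_seed {B : Matrix (Fin n) (Fin n) ℤ} (hB : SkewSymmetrizable B)
    {s : Matrix (Fin n) (Fin n) ℤ × (Fin n → CAField n)} (hs : IsSeed B s) :
    SkewSymmetrizable s.1 := by
  unfold IsSeed at hs
  induction hs with
  | refl => exact hB
  | tail _ h ih =>
    obtain ⟨k, rfl⟩ := h
    exact skew_mut k ih

/-- left end points of a nested chain of arcs -/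
def chainA (e : ℕ → ℤ) (i : ℕ) : ℤ := -∑ j ∈ Finset.range i, e j

lemma chainA_succ (e : ℕ → ℤ) (i : ℕ) : chainA e (i + 1) = chainA e i - e i := by
  unfold chainA; rw [Finset.sum_range_succ]; ring

lemma chainA_mono {e : ℕ → ℤ} (he : ∀ i, e i = 0 ∨ e i = 1) {p r : ℕ} (h : p ≤ r) :
    chainA e r ≤ chainA e p ∧ chainA e p + p ≤ chainA e r + r := by
  induction r, h using Nat.le_induction with
  | base => exact ⟨le_rfl, le_rfl⟩
  | succ r _ ih =>
    rw [chainA_succ]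
    have := he r
    push_cast
    omega

/-- apex of the arcs in a nested chain -/
def chainB (e : ℕ → ℤ) : ℕ → ℤ
  | 0 => chainA e 0 + 1
  | i + 1 => if e i = 1 then chainA e i else chainA e i + i + 2

lemma chainB_cases {e : ℕ → ℤ} (he : ∀ i, e i = 0 ∨ e i = 1) (q : ℕ) :
    (q = 0 ∧ chainB e q = chainA e q + 1) ∨ ∃ r, q = r + 1 ∧
    ((e r = 1 ∧ chainA e r = chainA e q + 1 ∧ chainB e q = chainA e q + 1) ∨
     (e r = 0 ∧ chainA e r = chainA e q ∧ chainB e q = chainA e q + q + 1)) := by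
  cases q with
  | zero => left; exact ⟨rfl, rfl⟩
  | succ r =>
    right
    refine ⟨r, rfl, ?_⟩
    have h := chainA_succ e r
    rcases he r with h0 | h1
    · right
      simp only [chainB, h0]
      push_cast
      refine ⟨trivial, by omega, ?_⟩
      omega
    · left
      simp only [chainB, h1]
      refine ⟨trivial, by omega, ?_⟩
      rw [if_pos trivial]; omega

def chainSys (e : ℕ → ℤ) (τ : Fin n ≃ Fin n) (δ : Fin n) : ArcSys n where
  x i := chainA e (τ i)
  y i := chainA e (τ i) + (τ i : ℕ) + 2
  β i := chainB e (τ i)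
  δ := δ

lemma chainSys_valid {e : ℕ → ℤ} (he : ∀ i, e i = 0 ∨ e i = 1) (τ : Fin n ≃ Fin n) (δ : Fin n)
    (hδ : ((τ δ : Fin n) : ℕ) + 1 = n) : (chainSys e τ δ).Valid (n + 1) := by
  have low : ∀ j, (τ j : ℕ) ≤ (τ δ : ℕ) := fun j => by have := (τ j).2; omega
  have bd : ∀ q : ℕ, chainA e q < chainB e q ∧ chainB e q < chainA e q + q + 2 := by
    intro q
    rcases chainB_cases he q with ⟨h0, h⟩ | ⟨r, hr, h | h⟩ <;> omega
  have nest : ∀ p q : ℕ, p < q → (chainA e q ≤ chainA e p ∧ chainA e p + p + 2 ≤ chainB e q) ∨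
      (chainB e q ≤ chainA e p ∧ chainA e p + p + 2 ≤ chainA e q + q + 2) := by
    intro p q hpq
    rcases chainB_cases he q with ⟨h0, h⟩ | ⟨r, hr, h | h⟩
    · omega
    · have := chainA_mono he (show p ≤ r by omega)
      right; omega
    · have := chainA_mono he (show p ≤ r by omega)
      left; omega
  have prev : ∀ j : Fin n, ∀ r : ℕ, (τ j : ℕ) = r + 1 → ∃ i, ((τ i : Fin n) : ℕ) = r := by
    intro j r h
    have := (τ j).2
    exact ⟨τ.symm ⟨r, by omega⟩, by simp⟩
  refine ⟨?_, ?_, ?_, ?_, ?_, ?_, ?_, ?_⟩ <;> simp only [chainSys]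
  · intro j; exact (bd _).1
  · intro j; exact (bd _).2
  · omega
  · intro j; exact (chainA_mono he (low j)).1
  · intro j; have := (chainA_mono he (low j)).2; omega
  · intro j
    rcases chainB_cases he (τ j) with ⟨h0, h⟩ | ⟨r, hr, h | h⟩
    · left; omega
    · left; omega
    · right
      obtain ⟨i, hi⟩ := prev j r hr
      refine ⟨i, ?_, ?_⟩ <;> rw [hi] <;> omega
  · intro j
    rcases chainB_cases he (τ j) with ⟨h0, h⟩ | ⟨r, hr, h | h⟩
    · left; omega
    · right
      obtain ⟨i, hi⟩ := prev j r hr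
      refine ⟨i, ?_, ?_⟩ <;> rw [hi] <;> omega
    · left; omega
  · intro i j hij
    have hne : (τ i : ℕ) ≠ (τ j : ℕ) := fun h => hij (τ.injective (Fin.ext h))
    rcases lt_or_gt_of_ne hne with h | h
    · have := nest _ _ h; omega
    · have := nest _ _ h; omega

lemma chainSys_lc {e : ℕ → ℤ} (he : ∀ i, e i = 0 ∨ e i = 1) (τ : Fin n ≃ Fin n) (δ i t : Fin n) :
    lc (chainSys e τ δ) i t = if (τ i : ℕ) + 1 = τ t then 1 - e (τ i) else 0 := by
  unfold lc chainSys
  dsimp only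
  split_ifs with h1 h2 h2
  · rcases chainB_cases he (τ t) with ⟨h0, h⟩ | ⟨r, hr, h | h⟩
    · omega
    · omega
    · obtain rfl : r = (τ i : ℕ) := by omega
      omega
  · exfalso
    rcases chainB_cases he (τ t) with ⟨h0, h⟩ | ⟨r, hr, h | h⟩ <;> omega
  · rcases chainB_cases he (τ t) with ⟨h0, h⟩ | ⟨r, hr, h⟩
    · omega
    · obtain rfl : r = (τ i : ℕ) := by omega
      rcases h with h | h <;> omega
  · rfl

lemma chainSys_rc {e : ℕ → ℤ} (he : ∀ i, e i = 0 ∨ e i = 1) (τ : Fin n ≃ Fin n) (δ i t : Fin n) :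
    rc (chainSys e τ δ) i t = if (τ i : ℕ) + 1 = τ t then e (τ i) else 0 := by
  unfold rc chainSys
  dsimp only
  split_ifs with h1 h2 h2
  · rcases chainB_cases he (τ t) with ⟨h0, h⟩ | ⟨r, hr, h | h⟩
    · omega
    · obtain rfl : r = (τ i : ℕ) := by omega
      omega
    · omega
  · exfalso
    rcases chainB_cases he (τ t) with ⟨h0, h⟩ | ⟨r, hr, h | h⟩ <;> omega
  · rcases chainB_cases he (τ t) with ⟨h0, h⟩ | ⟨r, hr, h⟩
    · omega
    · obtain rfl : r = (τ i : ℕ) := by omega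
      rcases h with h | h <;> omega
  · rfl

lemma chainSys_quivQ {e : ℕ → ℤ} (he : ∀ i, e i = 0 ∨ e i = 1) (τ : Fin n ≃ Fin n) (δ i j : Fin n) :
    quivQ (chainSys e τ δ) i j = if (τ i : ℕ) + 1 = τ j then 2 * e (τ i) - 1
      else if (τ j : ℕ) + 1 = τ i then 1 - 2 * e (τ j) else 0 := by
  have h1 : ∀ t, lc (chainSys e τ δ) i t * rc (chainSys e τ δ) j t -
      lc (chainSys e τ δ) j t * rc (chainSys e τ δ) i t = 0 := by
    intro t
    rw [chainSys_lc he, chainSys_rc he, chainSys_lc he, chainSys_rc he]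
    split_ifs with a b
    · have : (τ i : ℕ) = τ j := by omega
      rw [this]; ring
    · ring
    · ring
    · ring
  have h2 : quivQ (chainSys e τ δ) i j = ∑ t, (rc (chainSys e τ δ) i t * dl j t +
      dl i t * lc (chainSys e τ δ) j t - rc (chainSys e τ δ) j t * dl i t
      - dl j t * lc (chainSys e τ δ) i t) := by
    unfold quivQ
    refine Finset.sum_congr rfl fun t _ => ?_
    have := h1 t
    unfold triQ
    linarith
  rw [h2]
  simp only [Finset.sum_sub_distrib, Finset.sum_add_distrib, dl, mul_ite, ite_mul, mul_one, one_mul,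
    mul_zero, zero_mul, Finset.sum_ite_eq, Finset.mem_univ, if_true]
  rw [chainSys_lc he, chainSys_rc he, chainSys_lc he, chainSys_rc he]
  split_ifs with a b
  · omega
  · ring
  · ring
  · ring

lemma exists_dynkin (hn : 2 ≤ n) {C : Matrix (Fin n) (Fin n) ℤ} (hC : SkewSymmetrizable C)
    (σ : Equiv.Perm (Fin n)) (h : ∀ i j, cartanCounterpart C (σ i) (σ j) = cartanB n i j) :
    ∃ S : ArcSys n, S.Valid (n + 1) ∧ exMat S = C := by
  classical
  let e : ℕ → ℤ := fun p => if hp : p + 1 < n then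
    (if 0 < C (σ ⟨p, by omega⟩) (σ ⟨p + 1, hp⟩) then 1 else 0) else 0
  have he : ∀ i, e i = 0 ∨ e i = 1 := by
    intro i; simp only [e]; split_ifs <;> simp
  rw [skew_iff] at hC
  obtain ⟨d, hd, hC⟩ := hC
  have hdiag : ∀ i, C i i = 0 := by
    intro i
    have h1 := hC i i
    have h2 := hd i
    have : d i * C i i = 0 := by omega
    rcases mul_eq_zero.1 this with h | h
    · omega
    · exact h
  have hpos : ∀ i j, 0 < C i j → C j i < 0 := by
    intro i j hij
    have h1 := hC i j
    have h2 := hd i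
    have h3 := hd j
    by_contra hh
    push Not at hh
    nlinarith [mul_pos h2 hij, mul_nonneg h3.le hh]
  have hneg : ∀ i j, C i j < 0 → 0 < C j i := by
    intro i j hij
    have h1 := hC i j
    have h2 := hd i
    have h3 := hd j
    by_contra hh
    push Not at hh
    nlinarith [mul_neg_of_pos_of_neg h2 hij, mul_nonpos_of_nonneg_of_nonpos h3.le hh]
  have habs : ∀ i j, i ≠ j → |C (σ i) (σ j)| = - cartanB n i j := by
    intro i j hij
    rw [← h i j]
    unfold cartanCounterpart
    rw [if_neg (fun hh => hij (σ.injective hh))]; ring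
  let last : Fin n := ⟨n - 1, by omega⟩
  refine ⟨chainSys e σ.symm (σ last), chainSys_valid he _ _ (by simp [last]; omega), ?_⟩
  have main : ∀ p q : Fin n, exMat (chainSys e σ.symm (σ last)) (σ p) (σ q) = C (σ p) (σ q) := by
    intro p q
    unfold exMat
    rw [chainSys_quivQ he]
    simp only [Equiv.symm_apply_apply]
    have hw : wt (chainSys e σ.symm (σ last)) (σ p) = if (p : ℕ) + 1 = n then 2 else 1 := by
      unfold wt chainSys
      simp only [σ.injective.eq_iff, Fin.ext_iff, last]
      split_ifs <;> omega
    rw [hw]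
    have pl := p.2
    have ql := q.2
    by_cases hpq : p = q
    · subst hpq
      rw [hdiag]; simp
    have hne : (p : ℕ) ≠ q := fun hh => hpq (Fin.ext hh)
    have ha := habs p q hpq
    have hb := habs q p (Ne.symm hpq)
    unfold cartanB at ha hb
    rw [if_neg hpq] at ha
    rw [if_neg (Ne.symm hpq)] at hb
    by_cases h1 : (p : ℕ) + 1 = q
    · rw [if_pos h1, if_neg (by omega)]
      rw [if_neg (by omega), if_pos (by omega)] at ha
      have ep : e p = if 0 < C (σ p) (σ q) then 1 else 0 := by
        simp only [e]
        rw [dif_pos (by omega)]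
        have : (⟨(p : ℕ) + 1, by omega⟩ : Fin n) = q := Fin.ext h1
        rw [this]
      rw [ep]
      rcases abs_cases (C (σ p) (σ q)) with hh | hh <;> split_ifs <;> omega
    · rw [if_neg h1]
      by_cases h2 : (q : ℕ) + 1 = p
      · rw [if_pos h2]
        rw [if_neg (by omega), if_pos (by omega)] at hb
        have ep : e q = if 0 < C (σ q) (σ p) then 1 else 0 := by
          simp only [e]
          rw [dif_pos (by omega)]
          have : (⟨(q : ℕ) + 1, by omega⟩ : Fin n) = p := Fin.ext h2
          rw [this]
        rw [ep]
        have k1 := hpos (σ q) (σ p)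
        have k2 := hneg (σ q) (σ p)
        by_cases h3 : (p : ℕ) + 1 = n
        · rw [if_pos (by omega)] at ha
          rw [if_pos h3]
          rcases abs_cases (C (σ p) (σ q)) with hh | hh <;>
          rcases abs_cases (C (σ q) (σ p)) with hh' | hh' <;> split_ifs <;> omega
        · rw [if_neg (by omega), if_pos (by omega)] at ha
          rw [if_neg h3]
          rcases abs_cases (C (σ p) (σ q)) with hh | hh <;>
          rcases abs_cases (C (σ q) (σ p)) with hh' | hh' <;> split_ifs <;> omega
      · rw [if_neg h2]
        rw [if_neg (by omega), if_neg (by omega)] at ha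
        have : C (σ p) (σ q) = 0 := by simpa using ha
        rw [this]; ring
  ext i j
  have := main (σ.symm i) (σ.symm j)
  simpa using this

/-- The initial matrix comes from a triangulation. -/
lemma exists_initial (hn : 2 ≤ n) {B : Matrix (Fin n) (Fin n) ℤ} (hB : SkewSymmetrizable B)
    (h : PatternOfType (cartanB n) B) : ∃ T : ArcSys n, T.Valid (n + 1) ∧ exMat T = B := by
  obtain ⟨s, hs, σ, hσ⟩ := h
  have h0 := exists_dynkin hn (skew_seed hB hs) σ hσ
  unfold IsSeed at hs
  clear hσ
  induction hs with
  | refl => exact h0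
  | tail _ hst ih =>
    obtain ⟨k, rfl⟩ := hst
    apply ih
    obtain ⟨S, V, hS⟩ := h0
    obtain ⟨S', V', -, hS', -⟩ := V.exists_mut k
    exact ⟨S', V', by rw [hS', hS]; exact mutMat_mutMat _ _⟩

end Dynkin

/-! ### Tropical exchange relations -/

section Tropical

variable {n : ℕ}

lemma ArcSys.Valid.inj {m : ℤ} {S : ArcSys n} (V : S.Valid m) {i j : Fin n}
    (hx : S.x i = S.x j) (hy : S.y i = S.y j) : i = j := by
  by_contra h
  have := V.hC i j h
  have := V.hxβ i
  have := V.hβy i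
  have := V.hxβ j
  have := V.hβy j
  omega

lemma sum_lc {m : ℤ} {S : ArcSys n} (V : S.Valid m) (f : ℤ → ℤ → ℤ) (hb : ∀ p, f p (p + 1) = 0)
    (t : Fin n) : ∑ i, lc S i t * f (S.x i) (S.y i) = f (S.x t) (S.β t) := by
  rcases V.hL t with h | ⟨i, h1, h2⟩
  · rw [h, hb]
    apply Finset.sum_eq_zero
    intro i _
    have := V.hxβ i
    have := V.hβy i
    unfold lc
    rw [if_neg (by omega), zero_mul]
  · rw [Finset.sum_eq_single i]
    · unfold lc; rw [if_pos ⟨h1, h2⟩, one_mul, h1, h2]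
    · intro j _ hj
      unfold lc
      rw [if_neg, zero_mul]
      intro hh
      exact hj (V.inj (by omega) (by omega))
    · simp

lemma sum_rc {m : ℤ} {S : ArcSys n} (V : S.Valid m) (f : ℤ → ℤ → ℤ) (hb : ∀ p, f p (p + 1) = 0)
    (t : Fin n) : ∑ i, rc S i t * f (S.x i) (S.y i) = f (S.β t) (S.y t) := by
  rcases V.hR t with h | ⟨i, h1, h2⟩
  · rw [h, hb]
    apply Finset.sum_eq_zero
    intro i _
    have := V.hxβ i
    have := V.hβy i
    unfold rc
    rw [if_neg (by omega), zero_mul]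
  · rw [Finset.sum_eq_single i]
    · unfold rc; rw [if_pos ⟨h1, h2⟩, one_mul, h1, h2]
    · intro j _ hj
      unfold rc
      rw [if_neg, zero_mul]
      intro hh
      exact hj (V.inj (by omega) (by omega))
    · simp

/-- Functions on arcs satisfying the tropical Ptolemy relations. -/
structure TropFun (m : ℤ) (f : ℤ → ℤ → ℤ) : Prop where
  shift : ∀ p v, f (p + m) (v + m) = f p v
  bd : ∀ p, f p (p + 1) = 0
  ptol : ∀ p0 p1 p2 p3, p0 < p1 → p1 < p2 → p2 < p3 → p3 ≤ p0 + m →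
    f p0 p2 + f p1 p3 = max (f p0 p1 + f p2 p3) (f p1 p2 + f p0 p3)
  loops : ∀ p q, p < q → q < p + m → f p (p + m) + f q (q + m) = 2 * max (f p q) (f q (p + m))

lemma cdeg_tropFun {m x y : ℤ} (hm : 0 < m) (hxy : x + 1 < y) (hxm : y ≤ x + m) :
    TropFun m (cdeg m x y) where
  shift p v := by have := cdeg_shift m x y p v 1; rwa [one_mul] at this
  bd p := cdeg_boundary rfl hxy
  ptol p0 p1 p2 p3 h1 h2 h3 h4 := cdeg_ptolemy hm h1 h2 h3 h4 (by omega) hxm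
  loops p q h1 h2 := cdeg_loops hm h1 h2 (by omega) hxm

lemma FlipL.trop {m : ℤ} {S S' : ArcSys n} {k l : Fin n} (F : FlipL S S' k l) (V : S.Valid m)
    {f : ℤ → ℤ → ℤ} (hf : TropFun m f) :
    f (S.x k) (S.y k) + f (S'.x k) (S'.y k) =
      max (∑ i, max (quivQ S i k) 0 * f (S.x i) (S.y i))
        (∑ i, max (-quivQ S i k) 0 * f (S.x i) (S.y i)) := by
  have hkl := F.hkl
  have b1 := V.hxβ k
  have b2 := V.hβy k
  have b3 := V.hxβ l
  have b4 := V.hβy l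
  have b5 := V.hwx l
  have b6 := V.hwy l
  have b7 := V.hδ
  have e1 := F.hx
  have e2 := F.hy
  have cs : ∀ i, max (quivQ S i k) 0 = rc S i k + dl i l ∧
      max (-quivQ S i k) 0 = lc S i k + rc S i l := by
    intro i
    by_cases hi : i = k
    · subst hi
      rw [quivQ_self]
      unfold rc lc dl
      rw [if_neg (by omega), if_neg hkl, if_neg (by omega), if_neg (by omega)]
      simp
    rw [quivQ_col F V i hi]
    unfold rc lc dl
    by_cases il : i = l
    · subst il
      rw [if_pos rfl]
      split_ifs <;> first | omega | (exfalso; omega)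
    · rw [if_neg il]
      split_ifs <;> first | omega | (exfalso; omega)
  have s1 : ∑ i, max (quivQ S i k) 0 * f (S.x i) (S.y i) = f (S.β k) (S.y k) + f (S.x l) (S.y l) := by
    rw [← sum_rc V f hf.bd k]
    have : f (S.x l) (S.y l) = ∑ i, dl i l * f (S.x i) (S.y i) := by
      simp [dl]
    rw [this, ← Finset.sum_add_distrib]
    refine Finset.sum_congr rfl fun i _ => ?_
    rw [(cs i).1]; ring
  have s2 : ∑ i, max (-quivQ S i k) 0 * f (S.x i) (S.y i) = f (S.x k) (S.β k) + f (S.β l) (S.y l) := by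
    rw [← sum_lc V f hf.bd k, ← sum_rc V f hf.bd l, ← Finset.sum_add_distrib]
    refine Finset.sum_congr rfl fun i _ => ?_
    rw [(cs i).2]; ring
  rw [s1, s2, F.x'k, F.y'k, max_comm, ← e2, ← e1]
  exact hf.ptol _ _ _ _ b1 b2 (by omega) (by omega)

lemma FlipRoot.trop {m : ℤ} {S S' : ArcSys n} (F : FlipRoot m S S') (V : S.Valid m)
    {f : ℤ → ℤ → ℤ} (hf : TropFun m f) :
    f (S.x S.δ) (S.y S.δ) + f (S'.x S.δ) (S'.y S.δ) =
      2 * max (∑ i, max (quivQ S i S.δ) 0 * f (S.x i) (S.y i))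
        (∑ i, max (-quivQ S i S.δ) 0 * f (S.x i) (S.y i)) := by
  have b1 := V.hxβ S.δ
  have b2 := V.hβy S.δ
  have b7 := V.hδ
  have cs : ∀ i, max (quivQ S i S.δ) 0 = rc S i S.δ ∧ max (-quivQ S i S.δ) 0 = lc S i S.δ := by
    intro i
    by_cases hi : i = S.δ
    · rw [hi, quivQ_self]
      unfold rc lc
      rw [if_neg (by omega), if_neg (by omega)]
      simp
    rw [quivQ_root V i hi]
    unfold rc lc
    split_ifs <;> first | omega | (exfalso; omega)
  have s1 : ∑ i, max (quivQ S i S.δ) 0 * f (S.x i) (S.y i) = f (S.β S.δ) (S.y S.δ) := by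
    rw [← sum_rc V f hf.bd S.δ]
    exact Finset.sum_congr rfl fun i _ => by rw [(cs i).1]
  have s2 : ∑ i, max (-quivQ S i S.δ) 0 * f (S.x i) (S.y i) = f (S.x S.δ) (S.β S.δ) := by
    rw [← sum_lc V f hf.bd S.δ]
    exact Finset.sum_congr rfl fun i _ => by rw [(cs i).2]
  rw [s1, s2, F.x'd, F.y'd, max_comm, b7]
  exact hf.loops _ _ b1 (by omega)

/-- Tropical mutation of a vector. -/
def tropMut (k : Fin n) (B : Matrix (Fin n) (Fin n) ℤ) (D : Fin n → ℤ) : Fin n → ℤ :=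
  Function.update D k (-D k + max (∑ i, max (B i k) 0 * D i) (∑ i, max (-B i k) 0 * D i))

lemma max_wt (S : ArcSys n) (i : Fin n) (q : ℤ) : max (wt S i * q) 0 = wt S i * max q 0 ∧
    max (-(wt S i * q)) 0 = wt S i * max (-q) 0 := by
  rcases wt_cases S i with h | h <;> rw [h] <;> omega

/-- Every mutation is realised by a flip, compatibly with tropical mutation. -/
lemma ArcSys.Valid.exists_mut_trop {m : ℤ} {S : ArcSys n} (V : S.Valid m) (k : Fin n) :
    ∃ S' : ArcSys n, S'.Valid m ∧ S'.δ = S.δ ∧ exMat S' = mutMat k (exMat S) ∧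
      ∀ f : ℤ → ℤ → ℤ, TropFun m f → ∀ D : Fin n → ℤ,
        (∀ j, wt S j * D j = f (S.x j) (S.y j)) →
        ∀ j, wt S' j * tropMut k (exMat S) D j = f (S'.x j) (S'.y j) := by
  obtain ⟨S', V', hδ, hB, hF⟩ := V.exists_mut k
  refine ⟨S', V', hδ, hB, ?_⟩
  intro f hf D hD j
  have hw : ∀ j, wt S' j = wt S j := fun j => by unfold wt; rw [hδ]
  rw [hw]
  have s1 : ∑ i, max (exMat S i k) 0 * D i = ∑ i, max (quivQ S i k) 0 * f (S.x i) (S.y i) := by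
    refine Finset.sum_congr rfl fun i _ => ?_
    rw [← hD i]; unfold exMat; rw [(max_wt S i _).1]; ring
  have s2 : ∑ i, max (-exMat S i k) 0 * D i = ∑ i, max (-quivQ S i k) 0 * f (S.x i) (S.y i) := by
    refine Finset.sum_congr rfl fun i _ => ?_
    rw [← hD i]; unfold exMat; rw [(max_wt S i _).2]; ring
  unfold tropMut
  rw [s1, s2]
  by_cases hj : j = k
  · subst hj
    rw [Function.update_self, mul_add, mul_neg, hD j]
    rcases hF with ⟨rfl, F⟩ | ⟨l, F | F⟩
    · have := F.trop V hf
      have h2 : wt S S.δ = 2 := by simp [wt]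
      rw [h2]
      linarith
    · have := F.trop V hf
      have h2 : wt S j = 1 := by unfold wt; rw [if_neg F.hk]
      rw [h2]
      linarith
    · have := F.trop V' hf
      have h2 : wt S j = 1 := by rw [← hw]; unfold wt; rw [if_neg F.hk]
      rw [h2]
      have hq : ∀ i, quivQ S' i j = - quivQ S i j := by
        intro i
        have h3 := congrFun (congrFun hB i) j
        simp only [mutMat, or_true, if_true] at h3
        unfold exMat at h3
        rw [hw] at h3
        have : wt S i * (quivQ S' i j + quivQ S i j) = 0 := by linarith
        rcases mul_eq_zero.1 this with h | h
        · rcases wt_cases S i with h' | h' <;> omega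
        · linarith
      have t1 : ∑ i, max (quivQ S' i j) 0 * f (S'.x i) (S'.y i) =
          ∑ i, max (-quivQ S i j) 0 * f (S.x i) (S.y i) := by
        refine Finset.sum_congr rfl fun i _ => ?_
        rw [hq]
        by_cases hi : i = j
        · subst hi; rw [quivQ_self]; simp
        · rw [F.x'o i hi, F.y'o i hi]
      have t2 : ∑ i, max (-quivQ S' i j) 0 * f (S'.x i) (S'.y i) =
          ∑ i, max (quivQ S i j) 0 * f (S.x i) (S.y i) := by
        refine Finset.sum_congr rfl fun i _ => ?_
        rw [hq, neg_neg]
        by_cases hi : i = j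
        · subst hi; rw [quivQ_self]; simp
        · rw [F.x'o i hi, F.y'o i hi]
      rw [t1, t2, max_comm] at this
      linarith
  · rw [Function.update_of_ne hj, hD]
    rcases hF with ⟨rfl, F⟩ | ⟨l, F | F⟩
    · rcases V.side hj with h | h
      · have := F.lo j hj h
        rw [this.1, this.2.1, hf.shift]
      · have := F.hi j hj h
        rw [this.1, this.2.1]
    · rw [F.x'o j hj, F.y'o j hj]
    · rw [F.x'o j hj, F.y'o j hj]

lemma ArcSys.Valid.len {m : ℤ} {S : ArcSys n} (V : S.Valid m) (i : Fin n) :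
    S.x i + 1 < S.y i ∧ S.y i ≤ S.x i + m := by
  have := V.hxβ i
  have := V.hβy i
  have := V.hwx i
  have := V.hwy i
  have := V.hδ
  omega

lemma ArcSys.Valid.crs_zero {m : ℤ} {S : ArcSys n} (V : S.Valid m) (i j : Fin n) :
    crs (S.x i) (S.y i) (S.x j) (S.y j) = 0 := by
  unfold crs
  rw [if_neg]
  by_cases h : i = j
  · subst h; omega
  have := V.hC i j h
  have := V.hxβ i
  have := V.hβy i
  have := V.hxβ j
  have := V.hβy j
  omega

lemma ArcSys.Valid.crossNum_zero {m : ℤ} {S : ArcSys n} (V : S.Valid m) (hm : 0 < m) (i j : Fin n) :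
    crossNum m (S.x i) (S.y i) (S.x j) (S.y j) = 0 := by
  have := V.hwx i
  have := V.hwy i
  have := V.hwx j
  have := V.hwy j
  have := V.hδ
  rw [crossNum_window hm (by omega) (by omega), V.crs_zero]

lemma ArcSys.Valid.eqv_iff {m : ℤ} {S : ArcSys n} (V : S.Valid m) (hm : 0 < m) (i j : Fin n) :
    Eqv m (S.x i) (S.y i) (S.x j) (S.y j) ↔ i = j := by
  have := V.hwx i
  have := V.hwy i
  have := V.hwx j
  have := V.hwy j
  have := V.hδ
  have := V.len i
  have := V.len j
  rw [Eqv_window hm (by omega) (by omega)]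
  constructor
  · rintro ⟨h1, h2⟩; exact V.inj h1 h2
  · rintro rfl; exact ⟨rfl, rfl⟩

lemma ArcSys.Valid.loop_iff {m : ℤ} {S : ArcSys n} (V : S.Valid m) (i : Fin n) :
    S.y i = S.x i + m ↔ i = S.δ := by
  have := V.hwx i
  have := V.hwy i
  have := V.hδ
  constructor
  · intro h; exact V.inj (by omega) (by omega)
  · rintro rfl; exact V.hδ

lemma ArcSys.Valid.cdeg_self {m : ℤ} {T : ArcSys n} (V : T.Valid m) (hm : 0 < m) (i j : Fin n) :
    wt T j * (if i = j then -1 else 0) = cdeg m (T.x i) (T.y i) (T.x j) (T.y j) := by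
  unfold cdeg
  rw [V.crossNum_zero hm]
  by_cases h : i = j
  · rw [if_pos h, if_pos ((V.eqv_iff hm i j).2 h)]
    subst h
    unfold wt
    by_cases h' : i = T.δ
    · rw [if_pos h', if_pos ((V.loop_iff i).2 h')]; norm_num
    · rw [if_neg h', if_neg (fun hh => h' ((V.loop_iff i).1 hh))]; norm_num
  · rw [if_neg h, if_neg (fun hh => h ((V.eqv_iff hm i j).1 hh))]; norm_num

end Tropical

/-! ## Part 4: orders of subtraction-free rational functions -/

section Orders

variable {n : ℕ}

lemma X_pow_dvd_iff_coeff {R : Type*} [CommRing R] (i : Fin n) (k : ℕ)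
    (f : MvPolynomial (Fin n) R) :
    (X i : MvPolynomial (Fin n) R) ^ k ∣ f ↔ ∀ a : Fin n →₀ ℕ, MvPolynomial.coeff a f ≠ 0 → k ≤ a i := by
  have e : (X i : MvPolynomial (Fin n) R) ^ k = MvPolynomial.monomial (Finsupp.single i k) 1 := by
    rw [MvPolynomial.X_pow_eq_monomial]
  rw [e, MvPolynomial.monomial_one_dvd_iff_modMonomial_eq_zero]
  have hle : ∀ a : Fin n →₀ ℕ, Finsupp.single i k ≤ a ↔ k ≤ a i := by
    intro a
    exact Finsupp.single_le_iff
  constructor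
  · intro h a ha
    by_contra hk
    apply ha
    rw [← MvPolynomial.coeff_modMonomial_of_not_le f (fun h' => hk ((hle a).1 h')), h]
    simp
  · intro h
    ext a
    by_cases hk : k ≤ a i
    · rw [MvPolynomial.coeff_modMonomial_of_le f ((hle a).2 hk)]; simp
    · rw [MvPolynomial.coeff_modMonomial_of_not_le f (fun h' => hk ((hle a).1 h'))]
      by_contra hne
      exact hk (h a (by simpa using hne))

/-- nonzero polynomials with nonnegative coefficients -/
def PosPoly (f : MvPolynomial (Fin n) ℚ) : Prop := f ≠ 0 ∧ ∀ a, 0 ≤ MvPolynomial.coeff a f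

lemma PosPoly.mul {f g : MvPolynomial (Fin n) ℚ} (hf : PosPoly f) (hg : PosPoly g) :
    PosPoly (f * g) := by
  classical
  refine ⟨mul_ne_zero hf.1 hg.1, fun a => ?_⟩
  rw [MvPolynomial.coeff_mul]
  exact Finset.sum_nonneg fun x _ => mul_nonneg (hf.2 _) (hg.2 _)

lemma PosPoly.add {f g : MvPolynomial (Fin n) ℚ} (hf : PosPoly f) (hg : PosPoly g) :
    PosPoly (f + g) := by
  refine ⟨fun h => hf.1 ?_, fun a => ?_⟩
  · ext a
    have := congrArg (MvPolynomial.coeff a) h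
    rw [MvPolynomial.coeff_add, MvPolynomial.coeff_zero] at this
    rw [MvPolynomial.coeff_zero]
    have := hf.2 a
    have := hg.2 a
    linarith
  · rw [MvPolynomial.coeff_add]
    exact add_nonneg (hf.2 a) (hg.2 a)

lemma PosPoly.one : PosPoly (1 : MvPolynomial (Fin n) ℚ) := by
  classical
  refine ⟨one_ne_zero, fun a => ?_⟩
  rw [MvPolynomial.coeff_one]
  split_ifs <;> norm_num

lemma PosPoly.X (i : Fin n) : PosPoly (X i : MvPolynomial (Fin n) ℚ) := by
  classical
  refine ⟨MvPolynomial.X_ne_zero i, fun a => ?_⟩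
  rw [MvPolynomial.coeff_X']
  split_ifs <;> norm_num

/-- order of vanishing along `X i` -/
def ordX (i : Fin n) (f : MvPolynomial (Fin n) ℚ) : ℕ := multiplicity (X i) f

lemma X_prime' (i : Fin n) : Prime (X i : MvPolynomial (Fin n) ℚ) := MvPolynomial.X_prime

lemma finMult (i : Fin n) {f : MvPolynomial (Fin n) ℚ} (hf : f ≠ 0) :
    FiniteMultiplicity (X i) f :=
  FiniteMultiplicity.of_not_isUnit (X_prime' i).not_isUnit hf

lemma ordX_mul (i : Fin n) {f g : MvPolynomial (Fin n) ℚ} (hf : f ≠ 0) (hg : g ≠ 0) :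
    ordX i (f * g) = ordX i f + ordX i g :=
  multiplicity_mul (X_prime' i) (finMult i (mul_ne_zero hf hg))

lemma le_ordX_iff (i : Fin n) {f : MvPolynomial (Fin n) ℚ} (hf : f ≠ 0) (k : ℕ) :
    k ≤ ordX i f ↔ X i ^ k ∣ f :=
  ((finMult i hf).pow_dvd_iff_le_multiplicity).symm

lemma ordX_add (i : Fin n) {f g : MvPolynomial (Fin n) ℚ} (hf : PosPoly f) (hg : PosPoly g) :
    ordX i (f + g) = min (ordX i f) (ordX i g) := by
  apply le_antisymm
  · rw [le_min_iff, le_ordX_iff i hf.1, le_ordX_iff i hg.1]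
    have h := (le_ordX_iff i (hf.add hg).1 _).1 le_rfl
    rw [X_pow_dvd_iff_coeff] at h
    rw [X_pow_dvd_iff_coeff, X_pow_dvd_iff_coeff]
    constructor
    · intro a ha
      apply h a
      rw [MvPolynomial.coeff_add]
      have := hf.2 a
      have := hg.2 a
      have : 0 < MvPolynomial.coeff a f := lt_of_le_of_ne (hf.2 a) ha.symm
      linarith
    · intro a ha
      apply h a
      rw [MvPolynomial.coeff_add]
      have := hf.2 a
      have := hg.2 a
      have : 0 < MvPolynomial.coeff a g := lt_of_le_of_ne (hg.2 a) ha.symm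
      linarith
  · rw [le_ordX_iff i (hf.add hg).1]
    exact dvd_add ((le_ordX_iff i hf.1 _).1 (min_le_left _ _))
      ((le_ordX_iff i hg.1 _).1 (min_le_right _ _))

lemma ordX_of_not_dvd (i : Fin n) {f : MvPolynomial (Fin n) ℚ} (h : ¬ X i ∣ f) : ordX i f = 0 :=
  multiplicity_eq_zero.2 h

lemma ordX_one (i : Fin n) : ordX i 1 = 0 :=
  ordX_of_not_dvd i (fun h => (X_prime' i).not_isUnit (isUnit_of_dvd_one h))

lemma ordX_X (i j : Fin n) : ordX i (X j) = if i = j then 1 else 0 := by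
  split_ifs with h
  · subst h
    have h1 : 1 ≤ ordX i (X i) := (le_ordX_iff i (MvPolynomial.X_ne_zero i) 1).2 (by simp)
    have h2 : ¬ 2 ≤ ordX i (X i) := by
      rw [le_ordX_iff i (MvPolynomial.X_ne_zero i), X_pow_dvd_iff_coeff]
      intro h
      have := h (Finsupp.single i 1) (by simp)
      simp at this
    omega
  · apply ordX_of_not_dvd
    rw [MvPolynomial.X_dvd_X]
    simp [h]

lemma ordX_pow (i : Fin n) {f : MvPolynomial (Fin n) ℚ} (hf : f ≠ 0) (k : ℕ) :
    ordX i (f ^ k) = k * ordX i f := by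
  induction k with
  | zero => rw [pow_zero, ordX_one, zero_mul]
  | succ k ih => rw [pow_succ, ordX_mul i (pow_ne_zero _ hf) hf, ih]; ring

lemma ordX_prod (i : Fin n) {ι : Type*} (s : Finset ι) (f : ι → MvPolynomial (Fin n) ℚ)
    (hf : ∀ j, f j ≠ 0) : ordX i (∏ j ∈ s, f j) = ∑ j ∈ s, ordX i (f j) := by
  classical
  induction s using Finset.induction_on with
  | empty => rw [Finset.prod_empty, Finset.sum_empty, ordX_one]
  | insert a s ha ih =>
    rw [Finset.prod_insert ha, Finset.sum_insert ha, ordX_mul i (hf a)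
      (Finset.prod_ne_zero_iff.2 fun j _ => hf j), ih]

/-- `y` is a quotient of positive polynomials, with pole order `D i` along `X i`. -/
def HasOrd (y : CAField n) (D : Fin n → ℤ) : Prop :=
  ∃ f g : MvPolynomial (Fin n) ℚ, PosPoly f ∧ PosPoly g ∧
    y = algebraMap _ (CAField n) f / algebraMap _ (CAField n) g ∧
    ∀ i, D i = (ordX i g : ℤ) - ordX i f

lemma algMap_ne {f : MvPolynomial (Fin n) ℚ} (hf : f ≠ 0) :
    algebraMap _ (CAField n) f ≠ 0 := by
  intro h
  apply hf
  apply IsFractionRing.injective (MvPolynomial (Fin n) ℚ) (CAField n)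
  rw [h, map_zero]

lemma HasOrd.one : HasOrd (1 : CAField n) 0 :=
  ⟨1, 1, PosPoly.one, PosPoly.one, by simp, fun i => by simp⟩

lemma HasOrd.ofVar (j : Fin n) : HasOrd (uVar n j) (fun i => if i = j then -1 else 0) :=
  ⟨X j, 1, PosPoly.X j, PosPoly.one, by simp [uVar], fun i => by
    rw [ordX_one, ordX_X]; split_ifs with h <;> simp [h]⟩

lemma HasOrd.mul {y z : CAField n} {D E : Fin n → ℤ} (hy : HasOrd y D) (hz : HasOrd z E) :
    HasOrd (y * z) (D + E) := by
  obtain ⟨f, g, hf, hg, rfl, hD⟩ := hy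
  obtain ⟨f', g', hf', hg', rfl, hE⟩ := hz
  refine ⟨f * f', g * g', hf.mul hf', hg.mul hg', ?_, fun i => ?_⟩
  · rw [map_mul, map_mul, div_mul_div_comm]
  · rw [ordX_mul i hf.1 hf'.1, ordX_mul i hg.1 hg'.1, Pi.add_apply, hD, hE]
    push_cast; ring

lemma HasOrd.inv {y : CAField n} {D : Fin n → ℤ} (hy : HasOrd y D) : HasOrd y⁻¹ (-D) := by
  obtain ⟨f, g, hf, hg, rfl, hD⟩ := hy
  refine ⟨g, f, hg, hf, by rw [inv_div], fun i => ?_⟩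
  rw [Pi.neg_apply, hD]; ring

lemma HasOrd.add {y z : CAField n} {D E : Fin n → ℤ} (hy : HasOrd y D) (hz : HasOrd z E) :
    HasOrd (y + z) (fun i => max (D i) (E i)) := by
  obtain ⟨f, g, hf, hg, rfl, hD⟩ := hy
  obtain ⟨f', g', hf', hg', rfl, hE⟩ := hz
  refine ⟨f * g' + g * f', g * g', (hf.mul hg').add (hg.mul hf'), hg.mul hg', ?_, fun i => ?_⟩
  · rw [map_mul, map_add, map_mul, map_mul, div_add_div _ _ (algMap_ne hg.1) (algMap_ne hg'.1)]
  · rw [ordX_add i (hf.mul hg') (hg.mul hf'), ordX_mul i hf.1 hg'.1, ordX_mul i hg.1 hf'.1,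
      ordX_mul i hg.1 hg'.1]
    have := hD i
    have := hE i
    push_cast
    omega

lemma HasOrd.pow {y : CAField n} {D : Fin n → ℤ} (hy : HasOrd y D) (k : ℕ) :
    HasOrd (y ^ k) (fun i => k * D i) := by
  induction k with
  | zero =>
    rw [pow_zero]
    convert HasOrd.one (n := n) using 1
    funext i; simp
  | succ k ih =>
    rw [pow_succ]
    convert ih.mul hy using 1
    funext i; simp; ring

lemma HasOrd.prod {ι : Type*} (s : Finset ι) {y : ι → CAField n} {D : ι → Fin n → ℤ}
    (h : ∀ j, HasOrd (y j) (D j)) : HasOrd (∏ j ∈ s, y j) (fun i => ∑ j ∈ s, D j i) := by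
  classical
  induction s using Finset.induction_on with
  | empty =>
    rw [Finset.prod_empty]
    convert HasOrd.one (n := n) using 1
    funext i; simp
  | insert a s ha ih =>
    rw [Finset.prod_insert ha]
    convert (h a).mul ih using 1
    funext i
    rw [Finset.sum_insert ha, Pi.add_apply]

/-- Pole orders mutate tropically. -/
lemma HasOrd.mut {s : Matrix (Fin n) (Fin n) ℤ × (Fin n → CAField n)} {D : Fin n → Fin n → ℤ}
    (h : ∀ j, HasOrd (s.2 j) (fun i => D i j)) (k : Fin n) (j : Fin n) :
    HasOrd ((mutSeed k s).2 j) (fun i => tropMut k s.1 (D i) j) := by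
  unfold mutSeed tropMut
  dsimp only
  by_cases hj : j = k
  · subst hj
    rw [Function.update_self]
    simp only [Function.update_self]
    have h1 := HasOrd.prod Finset.univ (fun i => (h i).pow (s.1 i j).toNat)
    have h2 := HasOrd.prod Finset.univ (fun i => (h i).pow (-(s.1 i j)).toNat)
    rw [div_eq_mul_inv]
    convert (h1.add h2).mul (h j).inv using 1
    funext i
    simp only [Pi.add_apply, Pi.neg_apply, Int.ofNat_toNat]
    ring
  · rw [Function.update_of_ne hj]
    convert h j using 1
    funext i
    rw [Function.update_of_ne hj]

lemma aeval_uVar (F : MvPolynomial (Fin n) ℤ) : MvPolynomial.aeval (uVar n) F =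
    algebraMap _ (CAField n) (MvPolynomial.map (Int.castRingHom ℚ) F) := by
  have : (MvPolynomial.aeval (R := ℤ) (uVar n)).toRingHom = (algebraMap (MvPolynomial (Fin n) ℚ)
      (CAField n)).comp (MvPolynomial.map (Int.castRingHom ℚ)) := by
    apply MvPolynomial.ringHom_ext
    · intro r; simp
    · intro i; simp [uVar]
  exact congrArg (fun φ : MvPolynomial (Fin n) ℤ →+* CAField n => φ F) this

lemma HasOrd.denom {y : CAField n} {D d : Fin n → ℤ} (h : HasOrd y D)
    (hd : IsDenomVec (uVar n) y d) : d = D := by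
  obtain ⟨f, g, hf, hg, hy, hD⟩ := h
  obtain ⟨F, hF, hy'⟩ := hd
  rw [aeval_uVar] at hy'
  set F' := MvPolynomial.map (Int.castRingHom ℚ) F with hF'
  have hnd : ∀ i, ¬ X i ∣ F' := by
    intro i hi
    apply hF i
    rw [← pow_one (X i), X_pow_dvd_iff_coeff] at hi ⊢
    intro a ha
    apply hi a
    rw [hF', MvPolynomial.coeff_map]
    simpa using ha
  have hu : ∀ i, uVar n i ≠ 0 := fun i => algMap_ne (MvPolynomial.X_ne_zero i)
  have hprod : (∏ i, uVar n i ^ d i) * ∏ i, uVar n i ^ (-d i).toNat = ∏ i, uVar n i ^ (d i).toNat := by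
    rw [← Finset.prod_mul_distrib]
    refine Finset.prod_congr rfl fun i _ => ?_
    rw [← zpow_natCast, ← zpow_natCast, ← zpow_add₀ (hu i)]
    congr 1
    omega
  have hne : (∏ i, uVar n i ^ d i) ≠ 0 := Finset.prod_ne_zero_iff.2 fun i _ => zpow_ne_zero _ (hu i)
  have hmap : ∀ e : Fin n → ℕ, ∏ i, uVar n i ^ e i =
      algebraMap _ (CAField n) (∏ i, (X i : MvPolynomial (Fin n) ℚ) ^ e i) := by
    intro e
    rw [map_prod]
    exact Finset.prod_congr rfl fun i _ => by rw [map_pow]; rfl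
  have key : f * (∏ i, (X i : MvPolynomial (Fin n) ℚ) ^ (d i).toNat) =
      g * F' * ∏ i, (X i : MvPolynomial (Fin n) ℚ) ^ (-d i).toNat := by
    apply IsFractionRing.injective (MvPolynomial (Fin n) ℚ) (CAField n)
    rw [map_mul, map_mul, map_mul, ← hmap, ← hmap, ← hprod]
    rw [hy, div_eq_div_iff (algMap_ne hg.1) hne] at hy'
    rw [← mul_assoc, hy']; ring
  funext i
  have hF0 : F' ≠ 0 := fun h => hnd i (h ▸ dvd_zero _)
  have hX : ∀ e : Fin n → ℕ, (∏ i, (X i : MvPolynomial (Fin n) ℚ) ^ e i) ≠ 0 := fun e =>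
    Finset.prod_ne_zero_iff.2 fun i _ => pow_ne_zero _ (MvPolynomial.X_ne_zero i)
  have hXo : ∀ e : Fin n → ℕ, ordX i (∏ i, (X i : MvPolynomial (Fin n) ℚ) ^ e i) = e i := by
    intro e
    rw [ordX_prod i _ _ (fun j => pow_ne_zero _ (MvPolynomial.X_ne_zero j))]
    simp only [ordX_pow i (MvPolynomial.X_ne_zero _), ordX_X]
    simp
  have hk := congrArg (ordX i) key
  rw [ordX_mul i hf.1 (hX _), ordX_mul i (mul_ne_zero hg.1 hF0) (hX _), ordX_mul i hg.1 hF0, hXo, hXo,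
    ordX_of_not_dvd i (hnd i)] at hk
  rw [hD]
  omega

end Orders

/-- Seeds and triangulations. -/
lemma seed_invariant {n : ℕ} {m : ℤ} (hm : 0 < m) {T : ArcSys n} (VT : T.Valid m)
    {s : Matrix (Fin n) (Fin n) ℤ × (Fin n → CAField n)} (hs : IsSeed (exMat T) s) :
    ∃ (S : ArcSys n) (D : Fin n → Fin n → ℤ), S.Valid m ∧ S.δ = T.δ ∧ exMat S = s.1 ∧
      (∀ i j, wt S j * D i j = cdeg m (T.x i) (T.y i) (S.x j) (S.y j)) ∧
      ∀ j, HasOrd (s.2 j) (fun i => D i j) := by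
  unfold IsSeed at hs
  induction hs with
  | refl =>
    exact ⟨T, fun i j => if i = j then -1 else 0, VT, rfl, rfl, fun i j => VT.cdeg_self hm i j,
      fun j => HasOrd.ofVar j⟩
  | tail _ hst ih =>
    obtain ⟨k, rfl⟩ := hst
    obtain ⟨S, D, V, hδ, hS, hD, hO⟩ := ih
    obtain ⟨S', V', hδ', hS', hT⟩ := V.exists_mut_trop k
    refine ⟨S', fun i => tropMut k (exMat S) (D i), V', hδ'.trans hδ, ?_, ?_, ?_⟩
    · rw [hS', hS]; rfl
    · intro i j
      exact hT _ (cdeg_tropFun hm (VT.len i).1 (VT.len i).2) (D i) (hD i) j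
    · intro j
      rw [hS]
      exact HasOrd.mut hO k j

/-! ## Part 5: linear independence -/

section Final

variable {n : ℕ}

lemma ArcSys.Valid.noncross {m : ℤ} {S : ArcSys n} (V : S.Valid m) (hm : 0 < m) {i j : Fin n}
    {a b c d : ℤ} (h1 : Eqv m (S.x i) (S.y i) a b) (h2 : Eqv m (S.x j) (S.y j) c d) :
    ¬ (a < c ∧ c < b ∧ b < d) := by
  obtain ⟨k, rfl, rfl⟩ := h1
  obtain ⟨l, rfl, rfl⟩ := h2
  have w1 := V.hwx i
  have w2 := V.hwy i
  have w3 := V.hwx j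
  have w4 := V.hwy j
  have w5 := V.hδ
  rcases mul_gap hm k l with h | h | h
  · have := V.crs_zero i j
    unfold crs at this
    split_ifs at this <;> omega
  · omega
  · omega

open Classical in
lemma arcs_independent {m : ℤ} (hm : 0 < m) {T S : ArcSys n} (VT : T.Valid m) (VS : S.Valid m)
    (c : Fin n → ℚ)
    (h : ∀ i, ∑ j, c j * (cdeg m (T.x i) (T.y i) (S.x j) (S.y j) : ℚ) = 0) (j : Fin n) : c j = 0 := by
  let W : ℤ → ℤ → ℚ := fun p v => ∑ j, c j * (if Eqv m (S.x j) (S.y j) p v then 1 else 0)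
  have hW : ∀ p v, W p v ≠ 0 → ∃ j, Eqv m (S.x j) (S.y j) p v := by
    intro p v hne
    by_contra hh
    push Not at hh
    apply hne
    apply Finset.sum_eq_zero
    intro j _
    rw [if_neg (hh j), mul_zero]
  have hexit : ∀ a e, ∑ p ∈ Finset.Ioo a e, exitW m W a e p =
      ∑ j, c j * (crossNum m (S.x j) (S.y j) a e : ℚ) := by
    intro a e
    have : ∀ p, exitW m W a e p = ∑ j, c j *
        exitW m (fun p v => if Eqv m (S.x j) (S.y j) p v then 1 else 0) a e p := by
      intro p
      unfold exitW
      simp only [W, mul_add, Finset.sum_add_distrib, Finset.mul_sum]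
      congr 1
      · exact Finset.sum_comm
      · exact Finset.sum_comm
    simp only [this]
    rw [Finset.sum_comm]
    refine Finset.sum_congr rfl fun j _ => ?_
    have hl := VS.len j
    rw [← Finset.mul_sum, crossNum_eq_exit hm (by omega) hl.2]
  have hTi : ∀ i, W (T.x i) (T.y i) = 0 ∧
      ∑ p ∈ Finset.Ioo (T.x i) (T.y i), exitW m W (T.x i) (T.y i) p = 0 := by
    intro i
    obtain ⟨lam, hlam, hl0⟩ : ∃ lam : ℤ, (if T.y i = T.x i + m then (2 : ℤ) else 1) = lam ∧ (lam : ℚ) ≠ 0 :=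
      ⟨_, rfl, by split_ifs <;> norm_num⟩
    have hJ : ∑ p ∈ Finset.Ioo (T.x i) (T.y i), exitW m W (T.x i) (T.y i) p =
        lam * W (T.x i) (T.y i) := by
      rw [hexit]
      have := h i
      rw [← sub_eq_zero, ← this]
      simp only [W]
      rw [Finset.mul_sum, ← Finset.sum_sub_distrib]
      refine Finset.sum_congr rfl fun j _ => ?_
      unfold cdeg
      rw [hlam, crossNum_symm m (S.x j)]
      by_cases hE : Eqv m (T.x i) (T.y i) (S.x j) (S.y j)
      · rw [if_pos hE, if_pos hE.symm]; push_cast; ring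
      · rw [if_neg hE, if_neg (fun h => hE h.symm)]; push_cast; ring
    have hW0 : W (T.x i) (T.y i) = 0 := by
      by_contra hne
      obtain ⟨j0, hj0⟩ := hW _ _ hne
      have : ∑ p ∈ Finset.Ioo (T.x i) (T.y i), exitW m W (T.x i) (T.y i) p = 0 := by
        rw [hexit]
        apply Finset.sum_eq_zero
        intro j _
        rw [crossNum_symm, ← hj0.crossNum, VS.crossNum_zero hm]; simp
      rw [hJ] at this
      exact hne ((mul_eq_zero.1 this).resolve_left hl0)
    exact ⟨hW0, by rw [hJ, hW0, mul_zero]⟩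
  have hall : ∀ p v, W p v = 0 := by
    refine weights_zero hm ?_ ?_ ?_ (fun a e => ∃ i, T.x i = a ∧ T.y i = e) ?_ (T.x T.δ)
      ⟨T.δ, rfl, VT.hδ⟩
    · intro a b e f h1 h2
      obtain ⟨i, hi⟩ := hW _ _ h1
      obtain ⟨j, hj⟩ := hW _ _ h2
      exact VS.noncross hm hi hj
    · intro p v hne
      obtain ⟨i, k, h1, h2⟩ := hW _ _ hne
      have := VS.len i
      omega
    · intro k p v
      simp only [W, Eqv.shift]
    · rintro a e ⟨i, rfl, rfl⟩
      refine ⟨(VT.len i).2, (hTi i).1, (hTi i).2, T.β i, VT.hxβ i, VT.hβy i, VT.hL i, VT.hR i⟩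
  have := hall (S.x j) (S.y j)
  simp only [W, VS.eqv_iff hm] at this
  simpa using this

end Final


theorem denominators_linearly_independent_type_B {n : ℕ} (hn : 2 ≤ n)
    (B : Matrix (Fin n) (Fin n) ℤ) (hB : SkewSymmetrizable B)
    (htype : PatternOfType (cartanB n) B)
    (s : Matrix (Fin n) (Fin n) ℤ × (Fin n → CAField n)) (hs : IsSeed B s)
    (d : Fin n → Fin n → ℤ) (hd : ∀ j, IsDenomVec (uVar n) (s.2 j) (d j)) :
    LinearIndependent ℚ (fun j : Fin n => fun i : Fin n => (d j i : ℚ)) := by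
  have hm : (0 : ℤ) < (n : ℤ) + 1 := by omega
  obtain ⟨T, VT, rfl⟩ := exists_initial hn hB htype
  obtain ⟨S, D, VS, -, -, hD, hO⟩ := seed_invariant hm VT hs
  have hdD : ∀ j i, d j i = D i j := fun j i => congrFun ((hO j).denom (hd j)) i
  rw [Fintype.linearIndependent_iff]
  intro g hg j
  have hw : (wt S j : ℚ) ≠ 0 := by rcases wt_cases S j with h | h <;> rw [h] <;> norm_num
  have := arcs_independent hm VT VS (fun j => g j / wt S j) (fun i => ?_) j
  · exact (div_eq_zero_iff.1 this).resolve_right hw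
  · have h1 := congrFun hg i
    simp only [Finset.sum_apply, Pi.smul_apply, smul_eq_mul, Pi.zero_apply] at h1
    rw [← h1]
    refine Finset.sum_congr rfl fun k _ => ?_
    have hw : (wt S k : ℚ) ≠ 0 := by rcases wt_cases S k with h | h <;> rw [h] <;> norm_num
    rw [← hD i k, hdD k i]
    push_cast
    field_simp
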